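/- arXiv:2511.05788 — 4 statements merged into one kernel-verified Lean document; each statement's English description precedes it below -/
import Mathlib

section
/- Consider the HAR-C method with budget B satisfying B ≥ Ū + 1. Suppose in addition that f is convex and that the initial sublevel set {x ∈ dom ψ : F(x) ≤ F(x^0)} has diameter at most R < ∞. Then for any accuracy ε > 0, every integer K satisfying K(1 − Ū/B) − Ū ≥ (p+1) · (2 α H_max R^{p+1} / (p! ε))^{1/p} yields F(x^K) − F(x⋆) ≤ ε, where H_max = max{H_0, L_p} and Ū = ⌈log_{(α+1)/2}(H_max/H_0)⌉. -/
open scoped BigOperators RealInnerProductSpace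

noncomputable section

/-- The `p`-th order Taylor polynomial `T_p(y; x)` of `f` at `x`, evaluated at `y`. -/
def taylorPoly {n : ℕ} (p : ℕ) (f : EuclideanSpace ℝ (Fin n) → ℝ)
    (x y : EuclideanSpace ℝ (Fin n)) : ℝ :=
  f x + ∑ ℓ ∈ Finset.Icc 1 p,
    (1 / (Nat.factorial ℓ : ℝ)) * iteratedFDeriv ℝ ℓ f x (fun _ => y - x)

/-- The regularized Taylor polynomial `Ω_p^σ(y; x)`. -/
def omegaReg {n : ℕ} (p : ℕ) (σ : ℝ) (f : EuclideanSpace ℝ (Fin n) → ℝ)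
    (x y : EuclideanSpace ℝ (Fin n)) : ℝ :=
  taylorPoly p f x y + σ / (Nat.factorial (p + 1) : ℝ) * ‖y - x‖ ^ (p + 1)

/-- `H_max = max {H₀, L_p}`. -/
def Hmax (H0 Lp : ℝ) : ℝ := max H0 Lp

/-- `Ū = ⌈log_{(α+1)/2} (H_max / H₀)⌉`. -/
def Ubar (α H0 Lp : ℝ) : ℤ := ⌈Real.logb ((α + 1) / 2) (Hmax H0 Lp / H0)⌉

/-- Taylor's formula with Lipschitz top-order term, for a finite chain `G 0, …, G p` of successive
derivatives on the real line. -/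
theorem abs_sub_taylor_sum_le (C : ℝ) (p : ℕ) : ∀ G : ℕ → ℝ → ℝ,
    (∀ ℓ < p, ∀ t, HasDerivAt (G ℓ) (G (ℓ + 1) t) t) →
    (∀ t ∈ Set.Icc (0 : ℝ) 1, |G p t - G p 0| ≤ C * t) →
    ∀ t ∈ Set.Icc (0 : ℝ) 1,
      |G 0 t - ∑ ℓ ∈ Finset.range (p + 1), G ℓ 0 * (t ^ ℓ / (Nat.factorial ℓ : ℝ))|
        ≤ C * (t ^ (p + 1) / (Nat.factorial (p + 1) : ℝ)) := by
  have hpow : ∀ (m : ℕ) (t : ℝ), HasDerivAt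
      (fun s : ℝ => s ^ (m + 1) / (Nat.factorial (m + 1) : ℝ)) (t ^ m / (Nat.factorial m : ℝ)) t := by
    intro m t
    refine ((hasDerivAt_pow (m + 1) t).div_const (Nat.factorial (m + 1) : ℝ)).congr_deriv ?_
    rw [Nat.factorial_succ]
    have : (Nat.factorial m : ℝ) ≠ 0 := by positivity
    push_cast
    field_simp
  induction p with
  | zero => intro G _ hC t ht; simpa using hC t ht
  | succ p ih =>
    intro G hG hC t ht
    have key := ih (fun ℓ => G (ℓ + 1)) (fun ℓ hℓ s => hG (ℓ + 1) (by omega) s) hC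
    have hderiv : ∀ s, HasDerivAt
        (fun s => G 0 s - ∑ ℓ ∈ Finset.range (p + 1 + 1), G ℓ 0 * (s ^ ℓ / (Nat.factorial ℓ : ℝ)))
        (G 1 s - ∑ ℓ ∈ Finset.range (p + 1), G (ℓ + 1) 0 * (s ^ ℓ / (Nat.factorial ℓ : ℝ))) s := by
      intro s
      refine (hG 0 (by omega) s).sub ?_
      have hsum : HasDerivAt (fun s => ∑ ℓ ∈ Finset.range (p + 1),
          G (ℓ + 1) 0 * (s ^ (ℓ + 1) / (Nat.factorial (ℓ + 1) : ℝ)))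
          (∑ ℓ ∈ Finset.range (p + 1), G (ℓ + 1) 0 * (s ^ ℓ / (Nat.factorial ℓ : ℝ))) s :=
        HasDerivAt.fun_sum fun ℓ _ => (hpow ℓ s).const_mul _
      convert hsum.add_const (G 0 0) using 2 with r
      rw [Finset.sum_range_succ']
      simp
    have := image_norm_le_of_norm_deriv_right_le_deriv_boundary (a := 0) (b := 1)
      (B := fun s => C * (s ^ (p + 1 + 1) / (Nat.factorial (p + 1 + 1) : ℝ)))
      (B' := fun s => C * (s ^ (p + 1) / (Nat.factorial (p + 1) : ℝ)))
      (fun s _ => (hderiv s).continuousAt.continuousWithinAt)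
      (fun s _ => (hderiv s).hasDerivWithinAt)
      (by rw [Finset.sum_range_succ']; simp)
      (fun s => (hpow (p + 1) s).const_mul C)
      (fun s hs => key s ⟨hs.1, hs.2.le⟩)
    exact this ht

theorem abs_sub_taylorPoly_le {n p : ℕ} {f : EuclideanSpace ℝ (Fin n) → ℝ} {Lp : ℝ}
    (hf : ContDiff ℝ p f)
    (hLip : ∀ x y : EuclideanSpace ℝ (Fin n),
      ‖iteratedFDeriv ℝ p f x - iteratedFDeriv ℝ p f y‖ ≤ Lp * ‖x - y‖)
    (x y : EuclideanSpace ℝ (Fin n)) :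
    |f y - taylorPoly p f x y| ≤ Lp / (Nat.factorial (p + 1) : ℝ) * ‖y - x‖ ^ (p + 1) := by
  set v := y - x with hv
  have hline : ∀ t : ℝ, HasDerivAt (fun t : ℝ => x + t • v) v t := fun t => by
    simpa using ((hasDerivAt_id t).smul_const v).const_add x
  have := abs_sub_taylor_sum_le (Lp * ‖v‖ ^ (p + 1)) p
    (fun ℓ t => iteratedFDeriv ℝ ℓ f (x + t • v) (fun _ => v))
    (fun ℓ hℓ t => by
      have hd : DifferentiableAt ℝ (iteratedFDeriv ℝ ℓ f) (x + t • v) :=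
        (hf.differentiable_iteratedFDeriv (by exact_mod_cast hℓ)) _
      have h1 := hd.hasFDerivAt.comp_hasDerivAt t (hline t)
      have h2 := ((ContinuousMultilinearMap.apply ℝ
        (fun _ : Fin ℓ => EuclideanSpace ℝ (Fin n)) ℝ (fun _ => v)).hasFDerivAt).comp_hasDerivAt t h1
      simpa [iteratedFDeriv_succ_apply_left, Function.comp_def, Fin.tail_def] using h2)
    (fun t ht => by
      simp only [zero_smul, add_zero]
      rw [← sub_apply, ← Real.norm_eq_abs]
      refine (ContinuousMultilinearMap.le_opNorm _ _).trans ?_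
      have h := hLip (x + t • v) x
      rw [add_sub_cancel_left, norm_smul, Real.norm_of_nonneg ht.1] at h
      simp only [Finset.prod_const, Finset.card_univ, Fintype.card_fin]
      calc _ ≤ Lp * (t * ‖v‖) * ‖v‖ ^ p := by gcongr
        _ = _ := by ring)
    1 (by simp)
  rw [Finset.sum_range_succ'] at this
  have hIcc : ∀ g : ℕ → ℝ, ∑ ℓ ∈ Finset.Icc 1 p, g ℓ = ∑ ℓ ∈ Finset.range p, g (ℓ + 1) := by
    intro g
    rw [Finset.range_eq_Ico, Finset.sum_Ico_add' g 0 p 1]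
    rfl
  rw [taylorPoly, hIcc, ← hv]
  convert this using 1
  · congr 1
    simp [hv, add_comm, mul_comm]
  · simp only [one_pow]; ring

theorem le_Ubar_of_pow_mul_le {α H0 Lp : ℝ} (hα : 1 < α) (hH0 : 0 < H0) {u : ℕ}
    (hu : ((α + 1) / 2) ^ u * H0 ≤ Hmax H0 Lp) : (u : ℤ) ≤ Ubar α H0 Lp := by
  have hq : 1 < (α + 1) / 2 := by linarith
  have hmax : 0 < Hmax H0 Lp := hH0.trans_le (le_max_left _ _)
  have h : (u : ℝ) ≤ Real.logb ((α + 1) / 2) (Hmax H0 Lp / H0) := by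
    rw [Real.le_logb_iff_rpow_le hq (by positivity), Real.rpow_natCast, le_div_iff₀ hH0]
    exact hu
  exact_mod_cast h.trans (Int.le_ceil _)

open Classical in
/-- With resets every `B` steps, each block contributes at most `Ū` unsuccessful iterations. -/
theorem count_unsuccessful_le {α Lp : ℝ} {H M : ℕ → ℝ} {B : ℕ} (hα : 1 < α) (hH0 : 0 < H 0)
    (hM0 : M 0 = H 0)
    (hM : ∀ k, 1 ≤ k →
      M k = if k % B = 0 then max (H 0) (H (k - 1)) else max (M (k - 1)) (H (k - 1)))
    (hH : ∀ k, H k ≤ Hmax (H 0) Lp) (hMle : ∀ k, M k ≤ Hmax (H 0) Lp) (k : ℕ) :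
    (Nat.count (fun j => ¬ 2 * H (j + 1) ≤ (α + 1) * M (j + 1)) k : ℤ)
      ≤ ((k / B : ℕ) : ℤ) * Ubar α (H 0) Lp + Ubar α (H 0) Lp := by
  have hinv : ∃ u : ℕ, ((α + 1) / 2) ^ u * H 0 ≤ max (M k) (H k) ∧
      (Nat.count (fun j => ¬ 2 * H (j + 1) ≤ (α + 1) * M (j + 1)) k : ℤ)
        ≤ ((k / B : ℕ) : ℤ) * Ubar α (H 0) Lp + u := by
    induction k with
    | zero => exact ⟨0, by simp [hM0], by simp⟩
    | succ k ih =>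
      obtain ⟨u, hu, hcount⟩ := ih
      have hstep : ∃ w : ℕ, ((α + 1) / 2) ^ w * H 0 ≤ M (k + 1) ∧
          (Nat.count (fun j => ¬ 2 * H (j + 1) ≤ (α + 1) * M (j + 1)) k : ℤ)
            ≤ (((k + 1) / B : ℕ) : ℤ) * Ubar α (H 0) Lp + w := by
        have hMk := hM (k + 1) (by omega)
        rw [Nat.succ_div]
        by_cases hB : (k + 1) % B = 0
        · rw [if_pos hB] at hMk
          refine ⟨0, by simp [hMk], ?_⟩
          rw [if_pos (Nat.dvd_of_mod_eq_zero hB)]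
          have := le_Ubar_of_pow_mul_le hα hH0 (hu.trans (max_le (hMle k) (hH k)))
          rw [Nat.cast_add, Nat.cast_one, Nat.cast_zero]
          linarith
        · rw [if_neg hB, Nat.add_sub_cancel] at hMk
          refine ⟨u, hMk ▸ hu, ?_⟩
          rw [if_neg fun h => hB (Nat.mod_eq_zero_of_dvd h)]
          simpa using hcount
      obtain ⟨w, hw, hcount'⟩ := hstep
      rw [Nat.count_succ]
      by_cases hS : 2 * H (k + 1) ≤ (α + 1) * M (k + 1)
      · exact ⟨w, hw.trans (le_max_left _ _), by simpa [hS] using hcount'⟩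
      · refine ⟨w + 1, le_trans ?_ (le_max_right _ _), ?_⟩
        · rw [pow_succ]
          have := mul_le_mul_of_nonneg_left hw (by linarith : 0 ≤ (α + 1) / 2)
          linarith
        · rw [if_pos hS, Nat.cast_add, Nat.cast_add, Nat.cast_one]
          linarith
  obtain ⟨u, hu, hcount⟩ := hinv
  have := le_Ubar_of_pow_mul_le hα hH0 (hu.trans (max_le (hMle k) (hH k)))
  linarith

theorem add_one_pow_mul_le_of_step {p N : ℕ} {a b D : ℝ} (hD : 0 ≤ D)
    (ha : (N : ℝ) ^ p * a ≤ ((p : ℝ) + 1) ^ (p + 1) * D)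
    (hstep : ∀ τ ∈ Set.Icc (0 : ℝ) 1, b ≤ (1 - τ) * a + D * τ ^ (p + 1)) :
    ((N + 1 : ℕ) : ℝ) ^ p * b ≤ ((p : ℝ) + 1) ^ (p + 1) * D := by
  rcases le_or_gt N p with hN | hN
  · have hb : b ≤ D := by simpa using hstep 1 (by simp)
    have hNp : ((N + 1 : ℕ) : ℝ) ≤ (p : ℝ) + 1 := by exact_mod_cast Nat.succ_le_succ hN
    calc ((N + 1 : ℕ) : ℝ) ^ p * b ≤ ((N + 1 : ℕ) : ℝ) ^ p * D := by gcongr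
      _ ≤ ((p : ℝ) + 1) ^ p * D := by gcongr
      _ ≤ ((p : ℝ) + 1) ^ (p + 1) * D := by
        gcongr
        · linarith [(Nat.cast_nonneg p : (0 : ℝ) ≤ p)]
        · omega
  · have hNpos : (0 : ℝ) < N := by exact_mod_cast (Nat.zero_le p).trans_lt hN
    have hpN : (p : ℝ) + 1 ≤ N := by exact_mod_cast hN
    have hp0 : (0 : ℝ) ≤ p := Nat.cast_nonneg p
    have hb := hstep (((p : ℝ) + 1) / (N + 1)) ⟨by positivity, by
      rw [div_le_one (by positivity)]; linarith⟩
    have hbern : 1 - (p : ℝ) / N ≤ ((N : ℝ) / (N + 1)) ^ p := by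
      have h := one_add_mul_le_pow (a := -(1 / ((N : ℝ) + 1))) (by
        have : 1 / ((N : ℝ) + 1) ≤ 1 := by rw [div_le_one (by positivity)]; linarith
        linarith) p
      have h1 : 1 + -(1 / ((N : ℝ) + 1)) = N / (N + 1) := by field_simp; ring
      have h2 : (p : ℝ) / (N + 1) ≤ p / N := by gcongr; linarith
      rw [h1] at h
      have h3 : (p : ℝ) * -(1 / ((N : ℝ) + 1)) = -(p / (N + 1)) := by ring
      linarith
    set c := ((p : ℝ) + 1) ^ (p + 1) * D with hc
    have hc0 : 0 ≤ c := by positivity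
    have hratio : ((N : ℝ) - p) * ((N : ℝ) + 1) ^ p ≤ N * (N : ℝ) ^ p := by
      rw [div_pow, le_div_iff₀ (by positivity)] at hbern
      have := mul_le_mul_of_nonneg_left hbern hNpos.le
      calc _ = (N : ℝ) * ((1 - (p : ℝ) / N) * ((N : ℝ) + 1) ^ p) := by field_simp
        _ ≤ _ := this
    have hmain : ((N : ℝ) - p) * ((N : ℝ) + 1) ^ p * a ≤ N * c := by
      rcases le_or_gt a 0 with ha0 | ha0
      · exact (mul_nonpos_of_nonneg_of_nonpos
          (mul_nonneg (by linarith) (by positivity)) ha0).trans (by positivity)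
      · calc _ ≤ N * (N : ℝ) ^ p * a := by gcongr
          _ = N * ((N : ℝ) ^ p * a) := by ring
          _ ≤ _ := by gcongr
    have hpos : (0 : ℝ) < (N : ℝ) + 1 := by positivity
    have hexp : ((N : ℝ) + 1) ^ p *
        ((1 - ((p : ℝ) + 1) / (N + 1)) * a + D * (((p : ℝ) + 1) / (N + 1)) ^ (p + 1))
        = (((N : ℝ) - p) * ((N : ℝ) + 1) ^ p * a + c) / (N + 1) := by
      rw [hc, div_pow, pow_succ ((N : ℝ) + 1)]
      field_simp
      ring
    push_cast
    calc _ ≤ _ := mul_le_mul_of_nonneg_left hb (by positivity)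
      _ = _ := hexp
      _ ≤ c := by rw [div_le_iff₀ hpos]; linarith

open Classical in
/-- Sublinear decrease of a monotone gap, driven by the steps at which `S` holds. -/
theorem count_pow_mul_le {p : ℕ} (hp : 1 ≤ p) {δ : ℕ → ℝ} {S : ℕ → Prop} {D : ℝ} (hD : 0 ≤ D)
    (hmono : ∀ k, δ (k + 1) ≤ δ k)
    (hstep : ∀ k, S k → ∀ τ ∈ Set.Icc (0 : ℝ) 1,
      δ (k + 1) ≤ (1 - τ) * δ k + D * τ ^ (p + 1)) (k : ℕ) :
    (Nat.count S k : ℝ) ^ p * δ k ≤ ((p : ℝ) + 1) ^ (p + 1) * D := by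
  induction k with
  | zero =>
    rw [Nat.count_zero, Nat.cast_zero, zero_pow (by omega), zero_mul]
    positivity
  | succ k ih =>
    rw [Nat.count_succ]
    by_cases hS : S k
    · rw [if_pos hS]
      exact add_one_pow_mul_le_of_step hD ih (hstep k hS)
    · rw [if_neg hS, add_zero]
      exact (mul_le_mul_of_nonneg_left (hmono k) (by positivity)).trans ih

theorem HARC_convex_complexity
    {n : ℕ} (p : ℕ) (hp : 1 ≤ p)
    (f : EuclideanSpace ℝ (Fin n) → ℝ) (Lp : ℝ)
    (hf : ContDiff ℝ p f)
    (hLip : ∀ x y : EuclideanSpace ℝ (Fin n),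
      ‖iteratedFDeriv ℝ p f x - iteratedFDeriv ℝ p f y‖ ≤ Lp * ‖x - y‖)
    (domψ : Set (EuclideanSpace ℝ (Fin n))) (ψ : EuclideanSpace ℝ (Fin n) → ℝ)
    (hdom_ne : domψ.Nonempty) (hdom_closed : IsClosed domψ) (hdom_conv : Convex ℝ domψ)
    (hψconv : ConvexOn ℝ domψ ψ) (hψlsc : LowerSemicontinuousOn ψ domψ)
    (xstar : EuclideanSpace ℝ (Fin n)) (hstar : xstar ∈ domψ)
    (hminF : ∀ z ∈ domψ, f xstar + ψ xstar ≤ f z + ψ z)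
    (α : ℝ) (hα : 1 < α)
    (x d : ℕ → EuclideanSpace ℝ (Fin n)) (H M : ℕ → ℝ)
    (hx0 : x 0 ∈ domψ) (hH0 : 0 < H 0) (hM0 : M 0 = H 0)
    (B : ℕ) (hB : Ubar α (H 0) Lp + 1 ≤ (B : ℤ))
    (hM : ∀ k, 1 ≤ k →
      M k = if k % B = 0 then max (H 0) (H (k - 1)) else max (M (k - 1)) (H (k - 1)))
    (hdmem : ∀ k, 1 ≤ k → x (k - 1) + d k ∈ domψ)
    (hdmin : ∀ k, 1 ≤ k → ∀ z ∈ domψ,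
      omegaReg p (α * M k) f (x (k - 1)) (x (k - 1) + d k) + ψ (x (k - 1) + d k)
        ≤ omegaReg p (α * M k) f (x (k - 1)) z + ψ z)
    (hdne : ∀ k, 1 ≤ k → d k ≠ 0)
    (hxk : ∀ k, 1 ≤ k →
      x k = if f (x (k - 1) + d k) + ψ (x (k - 1) + d k) ≤ f (x (k - 1)) + ψ (x (k - 1))
            then x (k - 1) + d k else x (k - 1))
    (hHk : ∀ k, 1 ≤ k → H k / (Nat.factorial (p + 1) : ℝ)
      = (f (x (k - 1) + d k) - taylorPoly p f (x (k - 1)) (x (k - 1) + d k)) / ‖d k‖ ^ (p + 1))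
    (hfconv : ConvexOn ℝ Set.univ f) (R : ℝ)
    (hR : ∀ z ∈ domψ, f z + ψ z ≤ f (x 0) + ψ (x 0) →
      ∀ w ∈ domψ, f w + ψ w ≤ f (x 0) + ψ (x 0) → ‖z - w‖ ≤ R)
    (ε : ℝ) (hε : 0 < ε) (K : ℕ)
    (hK : ((p : ℝ) + 1)
          * (2 * α * Hmax (H 0) Lp * R ^ (p + 1) / ((Nat.factorial p : ℝ) * ε)) ^ ((1 : ℝ) / (p : ℝ))
      ≤ (K : ℝ) * (1 - (Ubar α (H 0) Lp : ℝ) / (B : ℝ)) - (Ubar α (H 0) Lp : ℝ)) :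
    f (x K) + ψ (x K) - (f xstar + ψ xstar) ≤ ε := by
  classical
  have htaylor := abs_sub_taylorPoly_le hf hLip
  have hfac : (0 : ℝ) < (Nat.factorial (p + 1) : ℝ) := by positivity
  have hmax : 0 < Hmax (H 0) Lp := hH0.trans_le (le_max_left _ _)
  have hdpow : ∀ k, 1 ≤ k → 0 < ‖d k‖ ^ (p + 1) := fun k hk =>
    pow_pos (norm_pos_iff.mpr (hdne k hk)) _
  have hH : ∀ k, H k ≤ Hmax (H 0) Lp := by
    intro k
    rcases Nat.eq_zero_or_pos k with rfl | hk
    · exact le_max_left _ _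
    · refine le_trans ?_ (le_max_right _ _)
      rw [← div_le_div_iff_of_pos_right hfac, hHk k hk, div_le_iff₀ (hdpow k hk)]
      simpa using (le_abs_self _).trans (htaylor (x (k - 1)) (x (k - 1) + d k))
  have hMle : ∀ k, M k ≤ Hmax (H 0) Lp := by
    intro k
    induction k with
    | zero => exact hM0.trans_le (le_max_left _ _)
    | succ k ih =>
      rw [hM (k + 1) (by omega), Nat.add_sub_cancel]
      split_ifs
      exacts [max_le (hH 0) (hH k), max_le ih (hH k)]
  have hMge : ∀ k, H 0 ≤ M k := by
    intro k
    induction k with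
    | zero => exact hM0.ge
    | succ k ih =>
      rw [hM (k + 1) (by omega), Nat.add_sub_cancel]
      split_ifs
      exacts [le_max_left _ _, ih.trans (le_max_left _ _)]
  have hxdom : ∀ k, x k ∈ domψ := by
    intro k
    induction k with
    | zero => exact hx0
    | succ k ih =>
      rw [hxk (k + 1) (by omega)]
      split_ifs
      exacts [hdmem (k + 1) (by omega), ih]
  have hmono : ∀ k, f (x (k + 1)) + ψ (x (k + 1)) ≤ f (x k) + ψ (x k) := by
    intro k
    rw [hxk (k + 1) (by omega), Nat.add_sub_cancel]
    split_ifs with h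
    exacts [h, le_rfl]
  have hhalf : ∀ k, f (x (k + 1)) + ψ (x (k + 1)) ≤
      f (x k + d (k + 1)) + ψ (x k + d (k + 1)) := by
    intro k
    rw [hxk (k + 1) (by omega), Nat.add_sub_cancel]
    split_ifs with h
    exacts [le_rfl, (not_le.mp h).le]
  have hsub : ∀ k, f (x k) + ψ (x k) ≤ f (x 0) + ψ (x 0) := fun k =>
    antitone_nat_of_succ_le (f := fun k => f (x k) + ψ (x k)) hmono (Nat.zero_le k)
  have hdist : ∀ k, ‖xstar - x k‖ ≤ R := fun k =>
    hR xstar hstar (hminF _ hx0) (x k) (hxdom k) (hsub k)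
  have hR0 : 0 ≤ R := (norm_nonneg _).trans (hdist 0)
  set D : ℝ := 2 * α * Hmax (H 0) Lp / (Nat.factorial (p + 1) : ℝ) * R ^ (p + 1) with hDdef
  have hD : 0 ≤ D := by positivity
  have hmodel : ∀ k, 2 * H (k + 1) ≤ (α + 1) * M (k + 1) → ∀ z ∈ domψ,
      f (x (k + 1)) + ψ (x (k + 1)) ≤ f z + ψ z
        + 2 * α * Hmax (H 0) Lp / (Nat.factorial (p + 1) : ℝ) * ‖z - x k‖ ^ (p + 1) := by
    intro k hS z hz
    have hMpos := hH0.trans_le (hMge (k + 1))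
    have hHle : H (k + 1) ≤ α * M (k + 1) := by nlinarith
    have hmin := hdmin (k + 1) (by omega) z hz
    have hHk' := hHk (k + 1) (by omega)
    rw [eq_div_iff (hdpow (k + 1) (by omega)).ne'] at hHk'
    rw [Nat.add_sub_cancel] at hmin hHk'
    have h1 : H (k + 1) / (Nat.factorial (p + 1) : ℝ) * ‖d (k + 1)‖ ^ (p + 1)
        ≤ α * M (k + 1) / (Nat.factorial (p + 1) : ℝ) * ‖d (k + 1)‖ ^ (p + 1) := by gcongr
    have h2 := neg_le_of_abs_le (htaylor (x k) z)
    simp only [omegaReg, add_sub_cancel_left] at hmin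
    have h3 : Lp / (Nat.factorial (p + 1) : ℝ) * ‖z - x k‖ ^ (p + 1)
        + α * M (k + 1) / (Nat.factorial (p + 1) : ℝ) * ‖z - x k‖ ^ (p + 1)
        ≤ 2 * α * Hmax (H 0) Lp / (Nat.factorial (p + 1) : ℝ) * ‖z - x k‖ ^ (p + 1) := by
      rw [← add_mul, ← add_div]
      gcongr
      have hLp : Lp ≤ Hmax (H 0) Lp := le_max_right _ _
      nlinarith [mul_le_mul_of_nonneg_left (hMle (k + 1)) (by linarith : 0 ≤ α)]
    linarith [hhalf k]
  have hstep : ∀ k, 2 * H (k + 1) ≤ (α + 1) * M (k + 1) → ∀ τ ∈ Set.Icc (0 : ℝ) 1,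
      f (x (k + 1)) + ψ (x (k + 1)) - (f xstar + ψ xstar)
        ≤ (1 - τ) * (f (x k) + ψ (x k) - (f xstar + ψ xstar)) + D * τ ^ (p + 1) := by
    intro k hS τ hτ
    have h1τ : 0 ≤ 1 - τ := sub_nonneg.mpr hτ.2
    have hz := hdom_conv (hxdom k) hstar h1τ hτ.1 (by ring)
    have hm := hmodel k hS _ hz
    have hcf := hfconv.2 (Set.mem_univ (x k)) (Set.mem_univ xstar) h1τ hτ.1 (by ring)
    have hcψ := hψconv.2 (hxdom k) hstar h1τ hτ.1 (by ring)
    have hzx : (1 - τ) • x k + τ • xstar - x k = τ • (xstar - x k) := by module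
    rw [hzx, norm_smul, Real.norm_of_nonneg hτ.1] at hm
    have hle : 2 * α * Hmax (H 0) Lp / (Nat.factorial (p + 1) : ℝ)
        * (τ * ‖xstar - x k‖) ^ (p + 1) ≤ D * τ ^ (p + 1) := by
      calc _ ≤ 2 * α * Hmax (H 0) Lp / (Nat.factorial (p + 1) : ℝ) * (τ * R) ^ (p + 1) := by
            have := hτ.1
            have := hdist k
            gcongr
        _ = _ := by rw [hDdef, mul_pow]; ring
    simp only [smul_eq_mul] at hcf hcψ
    linarith
  have hrate := count_pow_mul_le (δ := fun k => f (x k) + ψ (x k) - (f xstar + ψ xstar))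
    (S := fun j => 2 * H (j + 1) ≤ (α + 1) * M (j + 1)) hp hD
    (fun k => sub_le_sub_right (hmono k) _) hstep K
  have hU := count_unsuccessful_le hα hH0 hM0 hM hH hMle K
  have hU0 : 0 ≤ Ubar α (H 0) Lp := by
    simpa using le_Ubar_of_pow_mul_le (u := 0) (Lp := Lp) hα hH0 (by simp [Hmax])
  have hsum : Nat.count (fun j => 2 * H (j + 1) ≤ (α + 1) * M (j + 1)) K
      + Nat.count (fun j => ¬ 2 * H (j + 1) ≤ (α + 1) * M (j + 1)) K = K := by
    generalize K = m
    induction m with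
    | zero => simp
    | succ m ih =>
      rw [Nat.count_succ, Nat.count_succ]
      split_ifs <;> omega
  set N := Nat.count (fun j => 2 * H (j + 1) ≤ (α + 1) * M (j + 1)) K
  have hN : (K : ℝ) * (1 - (Ubar α (H 0) Lp : ℝ) / (B : ℝ)) - (Ubar α (H 0) Lp : ℝ) ≤ N := by
    have hUR : ((Nat.count (fun j => ¬ 2 * H (j + 1) ≤ (α + 1) * M (j + 1)) K : ℕ) : ℝ)
        ≤ ((K / B : ℕ) : ℝ) * (Ubar α (H 0) Lp : ℝ) + (Ubar α (H 0) Lp : ℝ) := by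
      have := (Int.cast_le (R := ℝ)).mpr hU
      simpa only [Int.cast_add, Int.cast_mul, Int.cast_natCast] using this
    have hsumR : (N : ℝ)
        + ((Nat.count (fun j => ¬ 2 * H (j + 1) ≤ (α + 1) * M (j + 1)) K : ℕ) : ℝ) = K := by
      exact_mod_cast hsum
    have hdiv : ((K / B : ℕ) : ℝ) * (Ubar α (H 0) Lp : ℝ)
        ≤ (K : ℝ) / B * (Ubar α (H 0) Lp : ℝ) :=
      mul_le_mul_of_nonneg_right Nat.cast_div_le (by exact_mod_cast hU0)
    have hexp : (K : ℝ) * (1 - (Ubar α (H 0) Lp : ℝ) / (B : ℝ))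
        = K - (K : ℝ) / B * (Ubar α (H 0) Lp : ℝ) := by ring
    linarith
  have hKN := hK.trans hN
  set Q : ℝ := 2 * α * Hmax (H 0) Lp * R ^ (p + 1) / ((Nat.factorial p : ℝ) * ε) with hQdef
  have hQ : 0 ≤ Q := by positivity
  rcases hR0.eq_or_lt with hR0' | hRpos
  · have hx : xstar = x K := by
      rw [← sub_eq_zero, ← norm_le_zero_iff, hR0']
      exact hdist K
    rw [← hx, sub_self]
    exact hε.le
  · have hQpos : 0 < Q := by positivity
    have hNpos : (0 : ℝ) < N := lt_of_lt_of_le (by positivity) hKN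
    have hpow : ((p : ℝ) + 1) ^ p * Q ≤ (N : ℝ) ^ p := by
      have := pow_le_pow_left₀ (by positivity) hKN p
      rwa [mul_pow, one_div, Real.rpow_inv_natCast_pow hQ (by omega)] at this
    have hc : ((p : ℝ) + 1) ^ (p + 1) * D = ((p : ℝ) + 1) ^ p * Q * ε := by
      rw [hDdef, hQdef, Nat.factorial_succ]
      push_cast
      field_simp
      ring
    have := hrate.trans (hc.trans_le (mul_le_mul_of_nonneg_right hpow hε.le))
    exact le_of_mul_le_mul_left this (by positivity)
end
end

section
/- Consider the HAR-C method with budget B satisfying B ≥ Ū + 1, and let ε_g > 0. If the integer K satisfies K(1 − Ū/B) − Ū ≥ (2(p+1)! (F(x^0) − F(x⋆)) / ((α−1) H_0)) · (2 α H_max / (p! ε_g))^{(p+1)/p}, then there exists an index k ≤ K and a subgradient u of ψ at x^k such that ‖∇f(x^k) + u‖ ≤ ε_g, i.e. dist(0, ∂F(x^k)) ≤ ε_g. If moreover ψ ≡ 0, p ≥ 2, ε_H > 0, and K also satisfies K(1 − Ū/B) − Ū ≥ (2(p+1)! (F(x^0) − F(x⋆)) / ((α−1) H_0)) · (2 α H_max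 / ((p−1)! ε_H))^{(p+1)/(p−1)}, then the same index k additionally satisfies ⟨∇²f(x^k) h, h⟩ ≥ −ε_H ‖h‖² for all h ∈ ℝ^n. Here H_max = max{H_0, L_p} and Ū = ⌈log_{(α+1)/2}(H_max/H_0)⌉. -/
open scoped BigOperators RealInnerProductSpace

noncomputable section

universe u

section Taylor

variable {E F : Type u} [NormedAddCommGroup E] [NormedSpace ℝ E]
  [NormedAddCommGroup F] [NormedSpace ℝ F]

theorem iteratedFDeriv_fderiv_fderiv_comm (n : ℕ) (f : E → F) (hf : ContDiff ℝ (n + 2 : ℕ) f)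
    (x : E) (m : Fin n → E) (v w : E) :
    iteratedFDeriv ℝ n (fderiv ℝ (fderiv ℝ f)) x m v w
      = iteratedFDeriv ℝ n (fderiv ℝ (fderiv ℝ f)) x m w v := by
  have h1 : ContDiff ℝ ((n + 1 : ℕ) : WithTop ℕ∞) (fderiv ℝ f) :=
    hf.fderiv_right (by norm_cast)
  have h2 : ContDiff ℝ (n : WithTop ℕ∞) (fderiv ℝ (fderiv ℝ f)) :=
    h1.fderiv_right (by norm_cast)
  let ev : E → E → ((E →L[ℝ] E →L[ℝ] F) →L[ℝ] F) := fun a b =>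
    (ContinuousLinearMap.apply ℝ F b).comp (ContinuousLinearMap.apply ℝ (E →L[ℝ] F) a)
  have hev : ∀ a b, iteratedFDeriv ℝ n (fderiv ℝ (fderiv ℝ f)) x m a b
      = iteratedFDeriv ℝ n (fun z => fderiv ℝ (fderiv ℝ f) z a b) x m := by
    intro a b
    have := (ev a b).iteratedFDeriv_comp_left (x := x) h2.contDiffAt (i := n) le_rfl
    have h3 := congrArg (fun A => A m) this
    simpa [ev, Function.comp_def] using h3.symm
  rw [hev, hev]
  congr 2
  funext z
  have hs : IsSymmSndFDerivAt ℝ f z := (hf.contDiffAt).isSymmSndFDerivAt (by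
    simp only [minSmoothness_of_isRCLikeNormedField]; exact_mod_cast (by omega : 2 ≤ n + 2))
  exact hs v w

theorem iteratedFDeriv_succ_update_const (n : ℕ) : ∀ {F : Type u} [NormedAddCommGroup F]
    [NormedSpace ℝ F] (f : E → F), ContDiff ℝ (n + 1 : ℕ) f → ∀ (x d v : E) (i : Fin (n + 1)),
    iteratedFDeriv ℝ (n + 1) f x (Function.update (fun _ => d) i v)
      = iteratedFDeriv ℝ n (fderiv ℝ f) x (fun _ => d) v := by
  induction n with
  | zero =>
    intro F _ _ f hf x d v i
    rw [iteratedFDeriv_succ_apply_right]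
    obtain rfl : i = 0 := Fin.fin_one_eq_zero i
    simp
  | succ n ih =>
    intro F _ _ f hf x d v i
    rw [iteratedFDeriv_succ_apply_right]
    induction i using Fin.lastCases with
    | last =>
      congr 2
      · funext j
        simp [Fin.init]
      · simp
    | cast i =>
      have h1 : ContDiff ℝ ((n + 1 : ℕ) : WithTop ℕ∞) (fderiv ℝ f) :=
        hf.fderiv_right (by norm_cast)
      have h2 : (Fin.init (Function.update (fun _ : Fin (n + 1 + 1) => d) i.castSucc v))
          = Function.update (fun _ => d) i v := by
        rw [Fin.init_update_castSucc]; rfl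
      rw [h2, ih _ h1, Function.update_of_ne (by exact (Fin.castSucc_lt_last i).ne'),
        iteratedFDeriv_fderiv_fderiv_comm n f hf, iteratedFDeriv_succ_apply_right]
      rfl

/-- The Taylor polynomial of order `q` of `g` at `x`, evaluated at `z`. -/
def taylorSum (q : ℕ) (g : E → F) (x z : E) : F :=
  ∑ ℓ ∈ Finset.range (q + 1),
    (1 / (Nat.factorial ℓ : ℝ)) • iteratedFDeriv ℝ ℓ g x (fun _ => z - x)

theorem hasFDerivAt_iteratedFDeriv_const (n : ℕ) (g : E → F) (hg : ContDiff ℝ (n + 1 : ℕ) g)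
    (x z : E) :
    HasFDerivAt (fun y => iteratedFDeriv ℝ (n + 1) g x (fun _ => y - x))
      (((n + 1 : ℕ) : ℝ) • iteratedFDeriv ℝ n (fderiv ℝ g) x (fun _ => z - x)) z := by
  have h := HasFDerivAt.multilinear_comp (f := iteratedFDeriv ℝ (n + 1) g x)
    (g := fun _ y => y - x) (g' := fun _ => ContinuousLinearMap.id ℝ E) (x := z)
    (fun _ => (hasFDerivAt_id z).sub_const x)
  convert! h using 1
  ext v
  simp [iteratedFDeriv_succ_update_const n g hg, ← Nat.cast_smul_eq_nsmul ℝ]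

theorem hasFDerivAt_taylorSum (q : ℕ) (g : E → F) (hg : ContDiff ℝ (q + 1 : ℕ) g) (x z : E) :
    HasFDerivAt (taylorSum (q + 1) g x) (taylorSum q (fderiv ℝ g) x z) z := by
  have h : ∀ ℓ ∈ Finset.range (q + 1), HasFDerivAt
      (fun y => (1 / (Nat.factorial (ℓ + 1) : ℝ)) • iteratedFDeriv ℝ (ℓ + 1) g x (fun _ => y - x))
      ((1 / (Nat.factorial ℓ : ℝ)) • iteratedFDeriv ℝ ℓ (fderiv ℝ g) x (fun _ => z - x)) z := by
    intro ℓ hℓ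
    have hℓ' : ℓ + 1 ≤ q + 1 := by simpa [Nat.lt_succ_iff] using hℓ
    have := (hasFDerivAt_iteratedFDeriv_const ℓ g (hg.of_le (by exact_mod_cast hℓ')) x z).const_smul
      (1 / (Nat.factorial (ℓ + 1) : ℝ))
    convert! this using 1
    rw [smul_smul]
    congr 1
    rw [Nat.factorial_succ]
    push_cast
    field_simp
  have h2 := (HasFDerivAt.fun_sum h).add_const (g x)
  unfold taylorSum
  convert! h2 using 2
  rw [Finset.sum_range_succ']
  simp

theorem taylorSum_self (q : ℕ) (g : E → F) (x : E) : taylorSum q g x x = g x := by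
  unfold taylorSum
  rw [Finset.sum_range_succ', Finset.sum_eq_zero]
  · simp
  · intro ℓ _
    rw [sub_self, show (fun _ : Fin (ℓ + 1) => (0 : E)) = 0 from rfl,
      ContinuousMultilinearMap.map_zero, smul_zero]

theorem norm_iteratedFDeriv_fderiv_sub (n : ℕ) (g : E → F) (x y : E) :
    ‖iteratedFDeriv ℝ n (fderiv ℝ g) x - iteratedFDeriv ℝ n (fderiv ℝ g) y‖
      = ‖iteratedFDeriv ℝ (n + 1) g x - iteratedFDeriv ℝ (n + 1) g y‖ := by
  rw [iteratedFDeriv_succ_eq_comp_right, iteratedFDeriv_succ_eq_comp_right, ← dist_eq_norm,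
    ← dist_eq_norm]
  exact ((continuousMultilinearCurryRightEquiv' ℝ n E F).symm.dist_map _ _).symm

theorem norm_sub_taylorSum_le (q : ℕ) : ∀ {F : Type u} [NormedAddCommGroup F]
    [NormedSpace ℝ F] (g : E → F) (L : ℝ), ContDiff ℝ q g →
    (∀ x y, ‖iteratedFDeriv ℝ q g x - iteratedFDeriv ℝ q g y‖ ≤ L * ‖x - y‖) →
    ∀ x z, ‖g z - taylorSum q g x z‖ ≤ L / (Nat.factorial (q + 1) : ℝ) * ‖z - x‖ ^ (q + 1) := by
  induction q with
  | zero =>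
    intro F _ _ g L hg hL x z
    have := hL z x
    rw [iteratedFDeriv_zero_eq_comp, Function.comp_apply, Function.comp_apply, ← map_sub,
      LinearIsometryEquiv.norm_map] at this
    simpa [taylorSum] using this
  | succ q ih =>
    intro F _ _ g L hg hL x z
    have h1 : ContDiff ℝ (q : WithTop ℕ∞) (fderiv ℝ g) := hg.fderiv_right (by norm_cast)
    have hR := ih (fderiv ℝ g) L h1 (fun a b => by
      rw [norm_iteratedFDeriv_fderiv_sub]; exact hL a b) x
    have hgd : Differentiable ℝ g := hg.differentiable (by simp)
    have hline : ∀ t : ℝ, HasDerivAt (fun s : ℝ => x + s • (z - x)) (z - x) t := fun t => by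
      simpa using ((hasDerivAt_id t).smul_const (z - x)).const_add x
    have hder : ∀ t : ℝ, HasDerivAt (fun s : ℝ => g (x + s • (z - x))
        - taylorSum (q + 1) g x (x + s • (z - x)))
        ((fderiv ℝ g (x + t • (z - x)) - taylorSum q (fderiv ℝ g) x (x + t • (z - x))) (z - x))
        t := fun t =>
      ((hgd _).hasFDerivAt.sub (hasFDerivAt_taylorSum q g hg x _)).comp_hasDerivAt t (hline t)
    have key := image_norm_le_of_norm_deriv_right_le_deriv_boundary (a := 0) (b := 1)
      (f := fun s : ℝ => g (x + s • (z - x)) - taylorSum (q + 1) g x (x + s • (z - x)))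
      (f' := fun t => (fderiv ℝ g (x + t • (z - x))
        - taylorSum q (fderiv ℝ g) x (x + t • (z - x))) (z - x))
      (B := fun t => L / (Nat.factorial (q + 1 + 1) : ℝ) * ‖z - x‖ ^ (q + 1 + 1) * t ^ (q + 1 + 1))
      (B' := fun t => L / (Nat.factorial (q + 1 + 1) : ℝ) * ‖z - x‖ ^ (q + 1 + 1)
        * (((q + 1 + 1 : ℕ) : ℝ) * t ^ (q + 1)))
      (fun t _ => (hder t).continuousAt.continuousWithinAt)
      (fun t _ => (hder t).hasDerivWithinAt)
      (by simp [taylorSum_self])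
      (fun t => by simpa using (hasDerivAt_pow (q + 1 + 1) t).const_mul _)
      (by
        intro t ht
        refine (ContinuousLinearMap.le_opNorm _ _).trans ?_
        have := hR (x + t • (z - x))
        rw [add_sub_cancel_left, norm_smul, Real.norm_of_nonneg ht.1] at this
        refine (mul_le_mul_of_nonneg_right this (norm_nonneg _)).trans_eq ?_
        rw [Nat.factorial_succ (q + 1)]
        push_cast
        field_simp
        ring)
    simpa using key (Set.right_mem_Icc.2 zero_le_one)

end Taylor

section Optimality

variable {E : Type*} [NormedAddCommGroup E]

theorem ConvexOn.le_add_of_forall_add_le [NormedSpace ℝ E] {D : Set E} {ψ G : E → ℝ}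
    (hψ : ConvexOn ℝ D ψ) {y : E} (hy : y ∈ D) {G' : E →L[ℝ] ℝ} (hG : HasFDerivAt G G' y)
    (hmin : ∀ z ∈ D, G y + ψ y ≤ G z + ψ z) {z : E} (hz : z ∈ D) :
    ψ y ≤ ψ z + G' (z - y) := by
  have hline : HasDerivAt (fun s : ℝ => y + s • (z - y)) (z - y) 0 := by
    simpa using ((hasDerivAt_id (0 : ℝ)).smul_const (z - y)).const_add y
  have hG0 : HasFDerivAt G G' (y + (0 : ℝ) • (z - y)) := by simpa using hG
  have hd : HasDerivAt (fun s : ℝ => G (y + s • (z - y)) + s * (ψ z - ψ y))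
      (G' (z - y) + (ψ z - ψ y)) 0 := by
    have h2 : HasDerivAt (fun s : ℝ => s * (ψ z - ψ y)) (1 * (ψ z - ψ y)) 0 :=
      (hasDerivAt_id (0 : ℝ)).mul_const _
    rw [one_mul] at h2
    exact (hG0.comp_hasDerivAt (0 : ℝ) hline).add h2
  have hm : IsMinOn (fun s : ℝ => G (y + s • (z - y)) + s * (ψ z - ψ y)) (Set.Icc 0 1) 0 := by
    intro s hs
    have hs1 : 0 ≤ 1 - s := sub_nonneg.2 hs.2
    have heq : y + s • (z - y) = (1 - s) • y + s • z := by
      rw [smul_sub, sub_smul, one_smul]; abel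
    have hmem : (1 - s) • y + s • z ∈ D := hψ.1 hy hz hs1 hs.1 (by ring)
    have hc := hψ.2 hy hz hs1 hs.1 (by ring)
    have := hmin _ hmem
    simp only [smul_eq_mul] at hc
    simp only [Set.mem_ofPred_eq, zero_smul, add_zero, zero_mul, heq]
    linarith
  have h1 : (1 : ℝ) ∈ posTangentConeAt (Set.Icc (0 : ℝ) 1) 0 :=
    mem_posTangentConeAt_of_segment_subset (by simp [segment_eq_Icc])
  have := hm.localize.hasFDerivWithinAt_nonneg hd.hasFDerivAt.hasFDerivWithinAt h1
  simp at this
  rw [map_sub]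
  linarith

theorem IsLocalMin.nonneg_of_hasDerivAt_of_hasDerivAt {φ φ' : ℝ → ℝ} {c a : ℝ}
    (hφ : ∀ t, HasDerivAt φ (φ' t) t) (hφ' : HasDerivAt φ' c a) (hm : IsLocalMin φ a) :
    0 ≤ c := by
  by_contra! hc
  have hd : deriv φ = φ' := funext fun t => (hφ t).deriv
  have hmax : IsLocalMax φ a := isLocalMax_of_deriv_deriv_neg
    (by rwa [hd, hφ'.deriv]) hm.deriv_eq_zero (hφ a).continuousAt
  have hconst : φ =ᶠ[nhds a] fun _ => φ a := by
    filter_upwards [hm, hmax] with t h1 h2 using le_antisymm h2 h1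
  have h2 := hconst.deriv.deriv.eq_of_nhds
  rw [hd, hφ'.deriv] at h2
  simp at h2
  exact hc.ne h2

theorem hasDerivAt_comp_add_smul [NormedSpace ℝ E] {G : E → ℝ} {G' : E → E →L[ℝ] ℝ}
    (hG : ∀ z, HasFDerivAt G (G' z) z) (y h : E) (t : ℝ) :
    HasDerivAt (fun s : ℝ => G (y + s • h)) (G' (y + t • h) h) t := by
  have hline : HasDerivAt (fun s : ℝ => y + s • h) h t := by
    simpa using ((hasDerivAt_id t).smul_const h).const_add y
  exact (hG _).comp_hasDerivAt t hline

theorem hasDerivAt_clm_comp_add_smul [NormedSpace ℝ E] {G' : E → E →L[ℝ] ℝ} {y : E}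
    {G'' : E →L[ℝ] E →L[ℝ] ℝ} (hG : HasFDerivAt G' G'' y) (h : E) :
    HasDerivAt (fun s : ℝ => G' (y + s • h) h) (G'' h h) 0 := by
  have hline : HasDerivAt (fun s : ℝ => y + s • h) h 0 := by
    simpa using ((hasDerivAt_id (0 : ℝ)).smul_const h).const_add y
  have hG0 : HasFDerivAt G' G'' (y + (0 : ℝ) • h) := by simpa using hG
  exact ((ContinuousLinearMap.apply ℝ ℝ h).hasFDerivAt).comp_hasDerivAt (0 : ℝ)
    (hG0.comp_hasDerivAt (0 : ℝ) hline)

theorem exists_hasDerivAt_norm_pow_line [InnerProductSpace ℝ E] (q : ℕ) {d : E} (hd : d ≠ 0)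
    (h : E) : ∃ (N' : ℝ → ℝ) (c : ℝ),
      (∀ t, HasDerivAt (fun s : ℝ => ‖d + s • h‖ ^ (q + 3)) (N' t) t) ∧ HasDerivAt N' c 0 ∧
      c ≤ ((q : ℝ) + 3) * ((q : ℝ) + 2) * ‖d‖ ^ (q + 1) * ‖h‖ ^ 2 := by
  set r : ℝ := ((q : ℝ) + 3) / 2 with hr
  have hq : (0 : ℝ) ≤ q := q.cast_nonneg
  have hdn : 0 < ‖d‖ := norm_pos_iff.2 hd
  have hsq : ∀ t : ℝ, ‖d + t • h‖ ^ 2 = ‖d‖ ^ 2 + 2 * t * ⟪d, h⟫ + t ^ 2 * ‖h‖ ^ 2 := by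
    intro t
    rw [norm_add_sq_real, inner_smul_right, norm_smul, mul_pow, Real.norm_eq_abs, sq_abs]
    ring
  have hN : (fun s : ℝ => ‖d + s • h‖ ^ (q + 3))
      = fun s => (‖d‖ ^ 2 + 2 * s * ⟪d, h⟫ + s ^ 2 * ‖h‖ ^ 2) ^ r := by
    funext s
    rw [← hsq, ← Real.rpow_natCast _ 2, ← Real.rpow_mul (norm_nonneg _), ← Real.rpow_natCast]
    congr 1
    rw [hr]; push_cast; ring
  have hQ : ∀ t : ℝ, HasDerivAt (fun s : ℝ => ‖d‖ ^ 2 + 2 * s * ⟪d, h⟫ + s ^ 2 * ‖h‖ ^ 2)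
      (2 * ⟪d, h⟫ + 2 * t * ‖h‖ ^ 2) t := by
    intro t
    have h1 : HasDerivAt (fun s : ℝ => 2 * s * ⟪d, h⟫) (2 * 1 * ⟪d, h⟫) t :=
      ((hasDerivAt_id t).const_mul 2).mul_const _
    have h2 : HasDerivAt (fun s : ℝ => s ^ 2 * ‖h‖ ^ 2) (2 * t * ‖h‖ ^ 2) t := by
      simpa using (hasDerivAt_pow 2 t).mul_const (‖h‖ ^ 2)
    convert! (h1.const_add (‖d‖ ^ 2)).add h2 using 1
    ring
  have hlin : HasDerivAt (fun s : ℝ => 2 * ⟪d, h⟫ + 2 * s * ‖h‖ ^ 2) (2 * ‖h‖ ^ 2) 0 := by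
    simpa using (((hasDerivAt_id (0 : ℝ)).const_mul 2).mul_const (‖h‖ ^ 2)).const_add (2 * ⟪d, h⟫)
  have hQ0 : (‖d‖ ^ 2 + 2 * 0 * ⟪d, h⟫ + 0 ^ 2 * ‖h‖ ^ 2 : ℝ) ≠ 0 := by
    have : 0 < ‖d‖ ^ 2 := by positivity
    simpa using hd
  refine ⟨_, _, ?_, (((hQ 0).rpow_const (p := r - 1) (Or.inl hQ0)).const_mul r).mul hlin, ?_⟩
  · intro t
    rw [hN]
    convert! (hQ t).rpow_const (p := r) (Or.inr (by rw [hr]; linarith)) using 1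
    rw [Pi.mul_apply]
    ring
  · have hs1 : (‖d‖ ^ 2 : ℝ) ^ (r - 1) = ‖d‖ ^ (q + 1) := by
      rw [← Real.rpow_natCast _ 2, ← Real.rpow_mul (norm_nonneg _), ← Real.rpow_natCast]
      congr 1
      rw [hr]; push_cast; ring
    have hs2 : (‖d‖ ^ 2 : ℝ) ^ (r - 1 - 1) * ‖d‖ ^ 2 = ‖d‖ ^ (q + 1) := by
      rw [← hs1, Real.rpow_sub_one (by positivity)]
      field_simp
    have hcs : ⟪d, h⟫ ^ 2 ≤ ‖d‖ ^ 2 * ‖h‖ ^ 2 := by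
      rw [← mul_pow, sq_le_sq, abs_of_nonneg (by positivity : 0 ≤ ‖d‖ * ‖h‖)]
      exact abs_real_inner_le_norm d h
    have hp0 : 0 ≤ (‖d‖ ^ 2 : ℝ) ^ (r - 1 - 1) := by positivity
    simp only [mul_zero, zero_mul, add_zero, ne_eq, OfNat.ofNat_ne_zero, not_false_eq_true,
      zero_pow]
    rw [hs1]
    have h4 : (‖d‖ ^ 2 : ℝ) ^ (r - 1 - 1) * ⟪d, h⟫ ^ 2 ≤ ‖d‖ ^ (q + 1) * ‖h‖ ^ 2 := by
      rw [← hs2, mul_assoc]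
      exact mul_le_mul_of_nonneg_left hcs hp0
    have hr0 : 0 ≤ 4 * (r * (r - 1)) := by
      rw [hr]; nlinarith
    have h5 := mul_le_mul_of_nonneg_left h4 hr0
    have h6 : ((q : ℝ) + 3) * ((q : ℝ) + 2) = 4 * (r * (r - 1)) + 2 * r := by rw [hr]; ring
    rw [h6]
    linarith

end Optimality

section Step

variable {n : ℕ} {f : EuclideanSpace ℝ (Fin n) → ℝ} {Lp σ : ℝ} {x d : EuclideanSpace ℝ (Fin n)}

theorem taylorPoly_eq_taylorSum (p : ℕ) (f : EuclideanSpace ℝ (Fin n) → ℝ)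
    (x y : EuclideanSpace ℝ (Fin n)) : taylorPoly p f x y = taylorSum p f x y := by
  have h : Finset.Icc 1 p = Finset.Ico 1 (p + 1) := by ext; simp
  rw [taylorPoly, taylorSum, h, Finset.range_eq_Ico,
    Finset.sum_eq_sum_Ico_succ_bot (Nat.succ_pos p)]
  simp

theorem exists_subgradient_norm_le {p : ℕ} (hp : 1 ≤ p) (hf : ContDiff ℝ p f)
    (hLip : ∀ x y : EuclideanSpace ℝ (Fin n),
      ‖iteratedFDeriv ℝ p f x - iteratedFDeriv ℝ p f y‖ ≤ Lp * ‖x - y‖)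
    {D : Set (EuclideanSpace ℝ (Fin n))} {ψ : EuclideanSpace ℝ (Fin n) → ℝ}
    (hψ : ConvexOn ℝ D ψ) (hσ : 0 ≤ σ) (hd : d ≠ 0) (hmem : x + d ∈ D)
    (hmin : ∀ z ∈ D, omegaReg p σ f x (x + d) + ψ (x + d) ≤ omegaReg p σ f x z + ψ z) :
    ∃ u : EuclideanSpace ℝ (Fin n), (∀ z ∈ D, ψ (x + d) + ⟪u, z - (x + d)⟫ ≤ ψ z) ∧
      ‖gradient f (x + d) + u‖ ≤ (Lp + σ) / (Nat.factorial p : ℝ) * ‖d‖ ^ p := by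
  obtain ⟨q, rfl⟩ := Nat.exists_eq_add_of_le' hp
  have hdn : 0 < ‖d‖ := norm_pos_iff.2 hd
  set κ : ℝ := σ / (Nat.factorial (q + 1 + 1) : ℝ) with hκ
  set N' : EuclideanSpace ℝ (Fin n) →L[ℝ] ℝ :=
    (((q + 2 : ℕ) : ℝ) * ‖d‖ ^ (((q + 2 : ℕ) : ℝ) - 2)) • innerSL ℝ d with hN'
  have hN : HasFDerivAt (fun z : EuclideanSpace ℝ (Fin n) => ‖z - x‖ ^ (q + 1 + 1)) N' (x + d) := by
    have h1 := hasFDerivAt_norm_rpow (x + d - x) (p := ((q + 2 : ℕ) : ℝ))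
      (by push_cast; have : (0 : ℝ) ≤ q := q.cast_nonneg; linarith)
    have h2 := h1.comp (x + d) ((hasFDerivAt_id (x + d)).sub_const x)
    simp only [Real.rpow_natCast, add_sub_cancel_left, ContinuousLinearMap.comp_id] at h2
    exact h2
  have hN'norm : ‖N'‖ = ((q : ℝ) + 2) * ‖d‖ ^ (q + 1) := by
    rw [hN', norm_smul, innerSL_apply_norm, Real.norm_of_nonneg (by positivity),
      show ((q + 2 : ℕ) : ℝ) - 2 = (q : ℕ) by push_cast; ring, Real.rpow_natCast]
    push_cast
    ring
  have hT := hasFDerivAt_taylorSum q f hf x (x + d)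
  set T' := taylorSum q (fderiv ℝ f) x (x + d) with hT'
  have hG : HasFDerivAt (omegaReg (q + 1) σ f x) (T' + κ • N') (x + d) := by
    have := hT.add (hN.const_mul κ)
    convert! this using 1
    funext z
    simp [omegaReg, taylorPoly_eq_taylorSum, hκ]
  refine ⟨-(InnerProductSpace.toDual ℝ _).symm (T' + κ • N'), ?_, ?_⟩
  · intro z hz
    have := hψ.le_add_of_forall_add_le hmem hG hmin hz
    rw [inner_neg_left, InnerProductSpace.toDual_symm_apply]
    linarith
  · have hR := norm_sub_taylorSum_le q (fderiv ℝ f) Lp (hf.fderiv_right (by norm_cast))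
      (fun a b => by rw [norm_iteratedFDeriv_fderiv_sub]; exact hLip a b) x (x + d)
    rw [add_sub_cancel_left] at hR
    rw [gradient, ← map_neg, ← map_add, LinearIsometryEquiv.norm_map,
      show fderiv ℝ f (x + d) + -(T' + κ • N') = (fderiv ℝ f (x + d) - T') - κ • N' by abel]
    refine (norm_sub_le _ _).trans ((add_le_add_left hR _).trans_eq ?_)
    rw [norm_smul, hN'norm, Real.norm_of_nonneg (by positivity), hκ, Nat.factorial_succ (q + 1)]
    push_cast
    field_simp
    ring

theorem hessian_ge {p : ℕ} (hp : 2 ≤ p) (hf : ContDiff ℝ p f)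
    (hLip : ∀ x y : EuclideanSpace ℝ (Fin n),
      ‖iteratedFDeriv ℝ p f x - iteratedFDeriv ℝ p f y‖ ≤ Lp * ‖x - y‖)
    (hσ : 0 ≤ σ) (hd : d ≠ 0)
    (hmin : ∀ z, omegaReg p σ f x (x + d) ≤ omegaReg p σ f x z) (h : EuclideanSpace ℝ (Fin n)) :
    -((Lp + σ) / (Nat.factorial (p - 1) : ℝ) * ‖d‖ ^ (p - 1) * ‖h‖ ^ 2)
      ≤ iteratedFDeriv ℝ 2 f (x + d) (fun _ => h) := by
  obtain ⟨q, rfl⟩ := Nat.exists_eq_add_of_le' hp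
  have hf1 : ContDiff ℝ ((q + 1 : ℕ) : WithTop ℕ∞) (fderiv ℝ f) := hf.fderiv_right (by norm_cast)
  have hf2 : ContDiff ℝ (q : WithTop ℕ∞) (fderiv ℝ (fderiv ℝ f)) :=
    hf1.fderiv_right (by norm_cast)
  set κ : ℝ := σ / (Nat.factorial (q + 2 + 1) : ℝ) with hκ
  have hκ0 : 0 ≤ κ := by positivity
  obtain ⟨N', c, hN', hN'', hc⟩ := exists_hasDerivAt_norm_pow_line q hd h
  have hT := hasDerivAt_comp_add_smul (fun z => hasFDerivAt_taylorSum (q + 1) f hf x z) (x + d) h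
  have hT2 := hasDerivAt_clm_comp_add_smul
    (hasFDerivAt_taylorSum q (fderiv ℝ f) hf1 x (x + d)) h
  set A := taylorSum q (fderiv ℝ (fderiv ℝ f)) x (x + d) with hA
  have hnonneg : 0 ≤ A h h + κ * c := by
    refine IsLocalMin.nonneg_of_hasDerivAt_of_hasDerivAt
      (fun t => (hT t).add ((hN' t).const_mul κ)) (hT2.add (hN''.const_mul κ))
      (Filter.Eventually.of_forall fun t => ?_)
    have := hmin (x + d + t • h)
    simpa [omegaReg, taylorPoly_eq_taylorSum, hκ, add_assoc] using this
  have hR := norm_sub_taylorSum_le q (fderiv ℝ (fderiv ℝ f)) Lp hf2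
    (fun a b => by
      rw [norm_iteratedFDeriv_fderiv_sub, norm_iteratedFDeriv_fderiv_sub]; exact hLip a b) x (x + d)
  rw [add_sub_cancel_left, ← hA] at hR
  have h1 : |fderiv ℝ (fderiv ℝ f) (x + d) h h - A h h|
      ≤ Lp / (Nat.factorial (q + 1) : ℝ) * ‖d‖ ^ (q + 1) * ‖h‖ ^ 2 := by
    have := (fderiv ℝ (fderiv ℝ f) (x + d) - A).le_opNorm₂ h h
    refine (show _ ≤ _ from this).trans ?_
    rw [mul_assoc, ← sq]
    exact mul_le_mul_of_nonneg_right hR (sq_nonneg _)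
  rw [iteratedFDeriv_two_apply]
  have h2 := mul_le_mul_of_nonneg_left hc hκ0
  have h3 : κ * (((q : ℝ) + 3) * ((q : ℝ) + 2) * ‖d‖ ^ (q + 1) * ‖h‖ ^ 2)
      = σ / (Nat.factorial (q + 1) : ℝ) * ‖d‖ ^ (q + 1) * ‖h‖ ^ 2 := by
    rw [hκ, Nat.factorial_succ (q + 2), Nat.factorial_succ (q + 1)]
    push_cast
    field_simp
    ring
  rw [h3] at h2
  have h4 := (abs_le.1 h1).1
  rw [show q + 2 - 1 = q + 1 from rfl, add_div, add_mul, add_mul]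
  linarith

theorem hessian_nonneg_of_forall_le (hf : ContDiff ℝ 2 f) (hmin : ∀ z, f x ≤ f z)
    (h : EuclideanSpace ℝ (Fin n)) : 0 ≤ iteratedFDeriv ℝ 2 f x (fun _ => h) := by
  have hf1 : ContDiff ℝ 1 (fderiv ℝ f) := hf.fderiv_right (by norm_num)
  have h1 := hasDerivAt_comp_add_smul
    (fun z => (hf.differentiable (by norm_num) z).hasFDerivAt) x h
  have h2 := hasDerivAt_clm_comp_add_smul (hf1.differentiable (by norm_num) x).hasFDerivAt h
  rw [iteratedFDeriv_two_apply]
  exact IsLocalMin.nonneg_of_hasDerivAt_of_hasDerivAt h1 h2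
    (Filter.Eventually.of_forall fun t => by simpa using hmin (x + t • h))

theorem exists_subgradient_eq_neg_gradient (hf : Differentiable ℝ f)
    {D : Set (EuclideanSpace ℝ (Fin n))} {ψ : EuclideanSpace ℝ (Fin n) → ℝ}
    (hψ : ConvexOn ℝ D ψ) (hmem : x ∈ D) (hmin : ∀ z ∈ D, f x + ψ x ≤ f z + ψ z) :
    ∃ u : EuclideanSpace ℝ (Fin n), (∀ z ∈ D, ψ x + ⟪u, z - x⟫ ≤ ψ z) ∧
      gradient f x + u = 0 := by
  refine ⟨-gradient f x, fun z hz => ?_, add_neg_cancel _⟩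
  have := hψ.le_add_of_forall_add_le hmem (hf x).hasFDerivAt hmin hz
  rw [inner_neg_left, gradient, InnerProductSpace.toDual_symm_apply]
  linarith

end Step

section Counting

theorem card_filter_mul_lt_le {c h₀ hmax : ℝ} (hc : 1 < c) (h₀pos : 0 < h₀) {H M : ℕ → ℝ}
    {B : ℕ} (hB : 0 < B) (hM0 : ∀ k, h₀ ≤ M k) (hMH : ∀ k, H k ≤ M (k + 1))
    (hMM : ∀ k, (k + 1) % B ≠ 0 → M k ≤ M (k + 1)) (hH : ∀ k, H k ≤ hmax) (hMmax : ∀ k, M k ≤ hmax)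
    (N : ℕ) :
    (((Finset.range (N + 1)).filter fun k => c * M k < H k).card : ℝ)
      ≤ ⌈Real.logb c (hmax / h₀)⌉ * ((N / B : ℕ) + 1 : ℝ) := by
  have hgrow : ∀ s j, j < B → h₀ * c ^ ((Finset.Ico (B * s) (B * s + j + 1)).filter
      fun k => c * M k < H k).card ≤ max (M (B * s + j)) (H (B * s + j)) := by
    intro s j
    induction j with
    | zero =>
      intro _
      by_cases hk : c * M (B * s) < H (B * s)
      · simp only [add_zero, Nat.Ico_succ_singleton, Finset.filter_singleton, hk, if_true,
          Finset.card_singleton, pow_one]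
        refine le_max_of_le_right (le_trans ?_ hk.le)
        rw [mul_comm]
        exact mul_le_mul_of_nonneg_left (hM0 _) (by linarith)
      · simp only [add_zero, Nat.Ico_succ_singleton, Finset.filter_singleton, hk, if_false,
          Finset.card_empty, pow_zero, mul_one]
        exact le_max_of_le_left (hM0 _)
    | succ j ih =>
      intro hj
      have ih' := ih (by omega)
      have hmod : (B * s + j + 1) % B ≠ 0 := by
        rw [add_assoc, Nat.mul_add_mod, Nat.mod_eq_of_lt hj]
        omega
      have hmono := ih'.trans (max_le (hMM _ hmod) (hMH _))
      rw [← add_assoc, ← Finset.insert_Ico_right_eq_Ico_add_one (by omega), Finset.filter_insert]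
      split_ifs with hk
      · rw [Finset.card_insert_of_notMem (by simp), pow_succ, ← mul_assoc]
        refine le_max_of_le_right (le_trans ?_ hk.le)
        rw [mul_comm]
        exact mul_le_mul_of_nonneg_left hmono (by linarith)
      · exact le_max_of_le_left hmono
  have hfib : ∀ s, ((Finset.Ico (B * s) (B * s + B)).filter fun k => c * M k < H k).card
      ≤ ⌈Real.logb c (hmax / h₀)⌉.toNat := by
    intro s
    have := (hgrow s (B - 1) (by omega)).trans (max_le (hMmax _) (hH _))
    rw [show B * s + (B - 1) + 1 = B * s + B by omega, mul_comm, ← le_div_iff₀ h₀pos] at this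
    have hpos : 0 < hmax / h₀ := lt_of_lt_of_le (by positivity) this
    have hlog := Real.logb_le_logb_of_le hc (by positivity) this
    rw [Real.logb_pow, Real.logb_self_eq_one hc, mul_one] at hlog
    have := hlog.trans (Int.le_ceil _)
    have h3 : (((Finset.Ico (B * s) (B * s + B)).filter fun k => c * M k < H k).card : ℤ)
      ≤ ⌈Real.logb c (hmax / h₀)⌉ := by exact_mod_cast this
    omega
  have hcard := Finset.card_le_mul_card_image_of_maps_to (f := fun k => k / B)
    (s := (Finset.range (N + 1)).filter fun k => c * M k < H k) (t := Finset.range (N / B + 1))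
    (fun k hk => by
      have := Finset.mem_range.1 (Finset.mem_filter.1 hk).1
      exact Finset.mem_range.2 (Nat.lt_succ_of_le (Nat.div_le_div_right (Nat.le_of_lt_succ this))))
    ⌈Real.logb c (hmax / h₀)⌉.toNat
    (fun s _ => le_trans (Finset.card_le_card fun k hk => by
      simp only [Finset.mem_filter, Finset.mem_Ico] at hk ⊢
      refine ⟨?_, hk.1.2⟩
      have := Nat.div_add_mod k B
      have := Nat.mod_lt k hB
      rw [hk.2] at *
      omega) (hfib s))
  have hceil : 0 ≤ ⌈Real.logb c (hmax / h₀)⌉ := by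
    refine Int.ceil_nonneg (Real.logb_nonneg hc ?_)
    rw [le_div_iff₀ h₀pos, one_mul]
    exact (hM0 0).trans (hMmax 0)
  rw [Finset.card_range] at hcard
  have : ((⌈Real.logb c (hmax / h₀)⌉.toNat : ℤ) : ℝ) = ⌈Real.logb c (hmax / h₀)⌉ := by
    rw [Int.toNat_of_nonneg hceil]
  rw [← this, Int.cast_natCast, ← Nat.cast_add_one, ← Nat.cast_mul]
  exact Nat.cast_le.2 hcard

theorem exists_successful_of_card_le {κ c Ub w Fstar : ℝ} {K B m : ℕ} (hm : m ≠ 0)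
    (hκ : 0 < κ) (hw : 0 < w) (hU : 0 ≤ Ub) {H M F δ : ℕ → ℝ} (hdec : ∀ k, 1 ≤ k → F k ≤ F (k - 1))
    (hsucc : ∀ k, 1 ≤ k → H k ≤ c * M k → F k ≤ F (k - 1) - κ * δ k ^ m)
    (hcard : (((Finset.range (K + 1)).filter fun k => c * M k < H k).card : ℝ)
      ≤ Ub * ((K / B : ℕ) + 1 : ℝ))
    (hlow : Fstar ≤ F K) (hpos : Fstar < F 0)
    (hK : (F 0 - Fstar) / κ * w ^ m ≤ K * (1 - Ub / B) - Ub) :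
    ∃ k, 1 ≤ k ∧ k ≤ K ∧ H k ≤ c * M k ∧ w * δ k ≤ 1 := by
  by_contra! hcon
  set S := (Finset.Icc 1 K).filter fun k => H k ≤ c * M k with hS
  have hsum : ∀ j, F j ≤ F 0 - ∑ k ∈ (Finset.Icc 1 j).filter (fun k => H k ≤ c * M k),
      κ * δ k ^ m := by
    intro j
    induction j with
    | zero => simp
    | succ j ih =>
      rw [← Finset.insert_Icc_right_eq_Icc_add_one (by omega), Finset.filter_insert]
      split_ifs with hk
      · rw [Finset.sum_insert (by simp)]
        have := hsucc (j + 1) (by omega) hk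
        simp only [Nat.add_sub_cancel] at this
        linarith
      · have := hdec (j + 1) (by omega)
        simp only [Nat.add_sub_cancel] at this
        linarith
  have hScard : (K : ℝ) * (1 - Ub / B) - Ub ≤ S.card := by
    have h1 := Finset.card_filter_add_card_filter_not (s := Finset.Icc 1 K)
      (fun k => H k ≤ c * M k)
    rw [Nat.card_Icc, Nat.add_sub_cancel] at h1
    have h2 : ((Finset.Icc 1 K).filter fun k => ¬ H k ≤ c * M k).card
        ≤ ((Finset.range (K + 1)).filter fun k => c * M k < H k).card := by
      refine Finset.card_le_card fun k hk => ?_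
      simp only [Finset.mem_filter, Finset.mem_Icc, not_le, Finset.mem_range] at hk ⊢
      exact ⟨by omega, hk.2⟩
    have h1' : (K : ℝ) = S.card + ((Finset.Icc 1 K).filter fun k => ¬ H k ≤ c * M k).card := by
      exact_mod_cast h1.symm
    have h2' : (((Finset.Icc 1 K).filter fun k => ¬ H k ≤ c * M k).card : ℝ)
        ≤ ((Finset.range (K + 1)).filter fun k => c * M k < H k).card := by exact_mod_cast h2
    have h3 : Ub * ((K / B : ℕ) : ℝ) ≤ Ub * (K / B) :=
      mul_le_mul_of_nonneg_left Nat.cast_div_le hU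
    have h4 : (K : ℝ) * (1 - Ub / B) = K - Ub * (K / B) := by ring
    rw [h4]
    linarith
  have hwm : 0 < w ^ m := pow_pos hw m
  have hΔ : 0 < F 0 - Fstar := sub_pos.2 hpos
  have hSpos : 0 < (S.card : ℝ) :=
    lt_of_lt_of_le (by positivity : 0 < (F 0 - Fstar) / κ * w ^ m) (hK.trans hScard)
  have hSne : S.Nonempty := Finset.card_pos.1 (by exact_mod_cast hSpos)
  have hstep : ∀ k ∈ S, κ / w ^ m < κ * δ k ^ m := by
    intro k hk
    simp only [hS, Finset.mem_filter, Finset.mem_Icc] at hk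
    have h1 := one_lt_pow₀ (hcon k hk.1.1 hk.1.2 hk.2) hm
    rw [mul_pow] at h1
    rw [div_lt_iff₀ hwm, mul_assoc]
    exact lt_mul_of_one_lt_right hκ (by linarith)
  have hlt := Finset.sum_lt_sum_of_nonempty hSne hstep
  rw [Finset.sum_const, nsmul_eq_mul] at hlt
  have h1 := hsum K
  have h2 := mul_le_mul_of_nonneg_right (hK.trans hScard) (by positivity : 0 ≤ κ / w ^ m)
  rw [show (F 0 - Fstar) / κ * w ^ m * (κ / w ^ m) = F 0 - Fstar by field_simp] at h2
  linarith

end Counting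

theorem mul_pow_le_one_of_root_mul_le_one {b δ : ℝ} (hb : 0 ≤ b) (hδ : 0 ≤ δ) {q : ℕ}
    (hq : q ≠ 0) (h : b ^ ((q : ℝ)⁻¹) * δ ≤ 1) : b * δ ^ q ≤ 1 := by
  have := pow_le_one₀ (n := q) (by positivity) h
  rwa [mul_pow, Real.rpow_inv_natCast_pow hb hq] at this

theorem rpow_div_eq_root_pow {b : ℝ} (hb : 0 ≤ b) (m q : ℝ) (k : ℕ) (hk : (k : ℝ) = m) :
    b ^ (m / q) = (b ^ (q⁻¹)) ^ k := by
  rw [← Real.rpow_natCast, ← Real.rpow_mul hb, hk, div_eq_inv_mul]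

theorem mul_pow_le_of_root_mul_le_one {A a ε c δ : ℝ} {q : ℕ} (hq : q ≠ 0) (ha : 0 < a)
    (hε : 0 < ε) (hA : 0 < A) (hδ : 0 ≤ δ) (hc : c ≤ A)
    (h : (A / (a * ε)) ^ ((q : ℝ)⁻¹) * δ ≤ 1) : c / a * δ ^ q ≤ ε := by
  have h1 := mul_pow_le_one_of_root_mul_le_one (by positivity) hδ hq h
  have h2 : A / a * δ ^ q ≤ ε := by
    rw [show A / (a * ε) * δ ^ q = (A / a * δ ^ q) / ε by field_simp, div_le_one hε] at h1
    exact h1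
  refine le_trans ?_ h2
  gcongr

theorem HARC_nonconvex_complexity
    {n : ℕ} (p : ℕ) (hp : 1 ≤ p)
    (f : EuclideanSpace ℝ (Fin n) → ℝ) (Lp : ℝ)
    (hf : ContDiff ℝ p f)
    (hLip : ∀ x y : EuclideanSpace ℝ (Fin n),
      ‖iteratedFDeriv ℝ p f x - iteratedFDeriv ℝ p f y‖ ≤ Lp * ‖x - y‖)
    (domψ : Set (EuclideanSpace ℝ (Fin n))) (ψ : EuclideanSpace ℝ (Fin n) → ℝ)
    (hdom_ne : domψ.Nonempty) (hdom_closed : IsClosed domψ) (hdom_conv : Convex ℝ domψ)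
    (hψconv : ConvexOn ℝ domψ ψ) (hψlsc : LowerSemicontinuousOn ψ domψ)
    (xstar : EuclideanSpace ℝ (Fin n)) (hstar : xstar ∈ domψ)
    (hminF : ∀ z ∈ domψ, f xstar + ψ xstar ≤ f z + ψ z)
    (α : ℝ) (hα : 1 < α)
    (x d : ℕ → EuclideanSpace ℝ (Fin n)) (H M : ℕ → ℝ)
    (hx0 : x 0 ∈ domψ) (hH0 : 0 < H 0) (hM0 : M 0 = H 0)
    (B : ℕ) (hB : Ubar α (H 0) Lp + 1 ≤ (B : ℤ))
    (hM : ∀ k, 1 ≤ k →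
      M k = if k % B = 0 then max (H 0) (H (k - 1)) else max (M (k - 1)) (H (k - 1)))
    (hdmem : ∀ k, 1 ≤ k → x (k - 1) + d k ∈ domψ)
    (hdmin : ∀ k, 1 ≤ k → ∀ z ∈ domψ,
      omegaReg p (α * M k) f (x (k - 1)) (x (k - 1) + d k) + ψ (x (k - 1) + d k)
        ≤ omegaReg p (α * M k) f (x (k - 1)) z + ψ z)
    (hdne : ∀ k, 1 ≤ k → d k ≠ 0)
    (hxk : ∀ k, 1 ≤ k →
      x k = if f (x (k - 1) + d k) + ψ (x (k - 1) + d k) ≤ f (x (k - 1)) + ψ (x (k - 1))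
            then x (k - 1) + d k else x (k - 1))
    (hHk : ∀ k, 1 ≤ k → H k / (Nat.factorial (p + 1) : ℝ)
      = (f (x (k - 1) + d k) - taylorPoly p f (x (k - 1)) (x (k - 1) + d k)) / ‖d k‖ ^ (p + 1))
    (K : ℕ) (εg εH : ℝ) (hεg : 0 < εg) (hεH : 0 < εH)
    (hK : (2 * (Nat.factorial (p + 1) : ℝ) * ((f (x 0) + ψ (x 0)) - (f xstar + ψ xstar))
          / ((α - 1) * H 0))
        * (2 * α * Hmax (H 0) Lp / ((Nat.factorial p : ℝ) * εg)) ^ (((p : ℝ) + 1) / (p : ℝ))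
      ≤ ((K : ℝ) * (1 - (Ubar α (H 0) Lp : ℝ) / (B : ℝ)) - (Ubar α (H 0) Lp : ℝ))) :
    ∃ k ≤ K,
      (∃ u : EuclideanSpace ℝ (Fin n),
        (∀ z ∈ domψ, ψ (x k) + ⟪u, z - x k⟫ ≤ ψ z) ∧ ‖gradient f (x k) + u‖ ≤ εg) ∧
      ((domψ = Set.univ ∧ (∀ z, ψ z = 0) ∧ 2 ≤ p ∧
          (2 * (Nat.factorial (p + 1) : ℝ) * ((f (x 0) + ψ (x 0)) - (f xstar + ψ xstar))
              / ((α - 1) * H 0))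
            * (2 * α * Hmax (H 0) Lp / ((Nat.factorial (p - 1) : ℝ) * εH))
              ^ (((p : ℝ) + 1) / ((p : ℝ) - 1))
          ≤ ((K : ℝ) * (1 - (Ubar α (H 0) Lp : ℝ) / (B : ℝ)) - (Ubar α (H 0) Lp : ℝ))) →
        ∀ h : EuclideanSpace ℝ (Fin n),
          -(εH * ‖h‖ ^ 2) ≤ iteratedFDeriv ℝ 2 f (x k) (fun _ => h)) := by
  have hα1 : 0 < α - 1 := sub_pos.2 hα
  have hmax0 : 0 < Hmax (H 0) Lp := lt_max_of_lt_left hH0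
  have hUnn : 0 ≤ Ubar α (H 0) Lp := by
    refine Int.ceil_nonneg (Real.logb_nonneg (by linarith) ?_)
    rw [le_div_iff₀ hH0, one_mul]
    exact le_max_left _ _
  have hBpos : 0 < B := by omega
  have hH_Lp : ∀ k, 1 ≤ k → H k ≤ Lp := by
    intro k hk
    have hdn : 0 < ‖d k‖ := norm_pos_iff.2 (hdne k hk)
    have h1 := norm_sub_taylorSum_le p f Lp hf hLip (x (k - 1)) (x (k - 1) + d k)
    rw [add_sub_cancel_left, ← taylorPoly_eq_taylorSum] at h1
    have h2 := (le_abs_self _).trans h1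
    rw [← div_le_iff₀ (by positivity), ← hHk k hk] at h2
    exact (div_le_div_iff_of_pos_right (by positivity)).1 h2
  have hH_max : ∀ k, H k ≤ Hmax (H 0) Lp := by
    intro k
    rcases Nat.eq_zero_or_pos k with rfl | hk
    · exact le_max_left _ _
    · exact (hH_Lp k hk).trans (le_max_right _ _)
  have hMH : ∀ k, H k ≤ M (k + 1) := by
    intro k
    rw [hM (k + 1) (by omega), Nat.add_sub_cancel]
    split_ifs
    · exact le_max_right _ _
    · exact le_max_right _ _
  have hMM : ∀ k, (k + 1) % B ≠ 0 → M k ≤ M (k + 1) := by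
    intro k hk
    rw [hM (k + 1) (by omega), Nat.add_sub_cancel, if_neg hk]
    exact le_max_left _ _
  have hM_ge : ∀ k, H 0 ≤ M k := by
    intro k
    induction k with
    | zero => exact hM0.ge
    | succ k ih =>
      by_cases hk : (k + 1) % B = 0
      · rw [hM (k + 1) (by omega), if_pos hk]
        exact le_max_left _ _
      · exact ih.trans (hMM k hk)
  have hM_le : ∀ k, M k ≤ Hmax (H 0) Lp := by
    intro k
    induction k with
    | zero => exact hM0.le.trans (hH_max 0)
    | succ k ih =>
      rw [hM (k + 1) (by omega), Nat.add_sub_cancel]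
      split_ifs
      · exact max_le (hH_max 0) (hH_max k)
      · exact max_le ih (hH_max k)
  have hx_mem : ∀ k, x k ∈ domψ := by
    intro k
    induction k with
    | zero => exact hx0
    | succ k ih =>
      rw [hxk (k + 1) (by omega)]
      split_ifs
      · exact hdmem (k + 1) (by omega)
      · exact ih
  have hcard := card_filter_mul_lt_le (c := (α + 1) / 2) (by linarith) hH0 hBpos hM_ge hMH hMM
    hH_max hM_le K
  set κ : ℝ := (α - 1) * H 0 / (2 * (Nat.factorial (p + 1) : ℝ)) with hκ
  have hκ0 : 0 < κ := by positivity
  have hdec : ∀ k, 1 ≤ k → f (x k) + ψ (x k) ≤ f (x (k - 1)) + ψ (x (k - 1)) := by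
    intro k hk
    rw [hxk k hk]
    split_ifs with h
    · exact h
    · exact le_rfl
  have hstep : ∀ k, 1 ≤ k → H k ≤ (α + 1) / 2 * M k →
      f (x (k - 1) + d k) + ψ (x (k - 1) + d k)
        ≤ f (x (k - 1)) + ψ (x (k - 1)) - κ * ‖d k‖ ^ (p + 1) := by
    intro k hk hs
    have hdn : 0 < ‖d k‖ := norm_pos_iff.2 (hdne k hk)
    have h1 := hdmin k hk _ (hx_mem (k - 1))
    simp only [omegaReg, add_sub_cancel_left, sub_self, norm_zero, taylorPoly_eq_taylorSum,
      taylorSum_self] at h1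
    rw [zero_pow (by omega), mul_zero, add_zero] at h1
    have h2 := hHk k hk
    rw [eq_div_iff (by positivity), taylorPoly_eq_taylorSum] at h2
    have h3 : κ * ‖d k‖ ^ (p + 1)
        ≤ (α * M k - H k) / (Nat.factorial (p + 1) : ℝ) * ‖d k‖ ^ (p + 1) := by
      refine mul_le_mul_of_nonneg_right ?_ (by positivity)
      rw [hκ, ← div_div]
      refine div_le_div_of_nonneg_right ?_ (by positivity)
      nlinarith [mul_le_mul_of_nonneg_left (hM_ge k) hα1.le]
    rw [sub_div, sub_mul] at h3
    linarith
  have hxs : ∀ k, 1 ≤ k → H k ≤ (α + 1) / 2 * M k → x k = x (k - 1) + d k := by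
    intro k hk hs
    have : 0 ≤ κ * ‖d k‖ ^ (p + 1) := by positivity
    rw [hxk k hk, if_pos (by linarith [hstep k hk hs])]
  rcases (hminF _ hx0).eq_or_lt with heq | hlt
  · have hmin0 : ∀ z ∈ domψ, f (x 0) + ψ (x 0) ≤ f z + ψ z := fun z hz => heq ▸ hminF z hz
    obtain ⟨u, hu, hu0⟩ := exists_subgradient_eq_neg_gradient
      (hf.differentiable (by exact_mod_cast (by omega : p ≠ 0))) hψconv hx0 hmin0
    refine ⟨0, Nat.zero_le _, ⟨u, hu, by simpa [hu0] using hεg.le⟩, ?_⟩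
    rintro ⟨rfl, hψ0, hp2, -⟩ h
    have h1 := hessian_nonneg_of_forall_le (x := x 0) (hf.of_le (by exact_mod_cast hp2))
      (fun z => by simpa [hψ0] using hmin0 z (Set.mem_univ _)) h
    exact le_trans (by simpa using (by positivity : 0 ≤ εH * ‖h‖ ^ 2)) h1
  have hcoef : 2 * (Nat.factorial (p + 1) : ℝ) * ((f (x 0) + ψ (x 0)) - (f xstar + ψ xstar))
      / ((α - 1) * H 0) = ((f (x 0) + ψ (x 0)) - (f xstar + ψ xstar)) / κ := by
    rw [hκ]
    field_simp
  rw [hcoef] at hK ⊢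
  rw [rpow_div_eq_root_pow (by positivity) _ _ (p + 1) (by push_cast; rfl)] at hK ⊢
  have hp1 : (p : ℝ) - 1 = ((p - 1 : ℕ) : ℝ) := by push_cast [hp]; rfl
  rw [hp1]
  set w₁ : ℝ := (2 * α * Hmax (H 0) Lp / ((Nat.factorial p : ℝ) * εg)) ^ ((p : ℝ)⁻¹) with hw₁
  set w₂ : ℝ := (2 * α * Hmax (H 0) Lp / ((Nat.factorial (p - 1) : ℝ) * εH))
    ^ (((p - 1 : ℕ) : ℝ)⁻¹) with hw₂
  have hA : 0 < 2 * α * Hmax (H 0) Lp := by positivity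
  have hw₁0 : 0 < w₁ := by positivity
  have hcoef_le : ∀ k, Lp + α * M k ≤ 2 * α * Hmax (H 0) Lp := by
    intro k
    have h1 : Lp ≤ Hmax (H 0) Lp := le_max_right _ _
    nlinarith [mul_le_mul_of_nonneg_left (hM_le k) (by linarith : 0 ≤ α),
      mul_pos hα1 hmax0]
  have hw : ∃ w, w₁ ≤ w ∧ ((domψ = Set.univ ∧ (∀ z, ψ z = 0) ∧ 2 ≤ p ∧
      ((f (x 0) + ψ (x 0)) - (f xstar + ψ xstar)) / κ * w₂ ^ (p + 1)
        ≤ (K : ℝ) * (1 - (Ubar α (H 0) Lp : ℝ) / (B : ℝ)) - (Ubar α (H 0) Lp : ℝ)) → w₂ ≤ w) ∧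
      ((f (x 0) + ψ (x 0)) - (f xstar + ψ xstar)) / κ * w ^ (p + 1)
        ≤ (K : ℝ) * (1 - (Ubar α (H 0) Lp : ℝ) / (B : ℝ)) - (Ubar α (H 0) Lp : ℝ) := by
    rcases le_total w₂ w₁ with h | h
    · exact ⟨w₁, le_rfl, fun _ => h, hK⟩
    · by_cases h2 : (domψ = Set.univ ∧ (∀ z, ψ z = 0) ∧ 2 ≤ p ∧
        ((f (x 0) + ψ (x 0)) - (f xstar + ψ xstar)) / κ * w₂ ^ (p + 1)
          ≤ (K : ℝ) * (1 - (Ubar α (H 0) Lp : ℝ) / (B : ℝ)) - (Ubar α (H 0) Lp : ℝ))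
      · exact ⟨w₂, h, fun _ => le_rfl, h2.2.2.2⟩
      · exact ⟨w₁, le_rfl, fun h3 => absurd h3 h2, hK⟩
  obtain ⟨w, hw1, hw2, hKw⟩ := hw
  obtain ⟨k, hk1, hkK, hks, hkw⟩ := exists_successful_of_card_le (H := H) (M := M)
    (F := fun k => f (x k) + ψ (x k)) (δ := fun k => ‖d k‖) (Nat.succ_ne_zero p) hκ0
    (hw₁0.trans_le hw1) (by exact_mod_cast hUnn) hdec
    (fun k hk hs => by simpa only [hxs k hk hs] using hstep k hk hs) hcard
    (hminF _ (hx_mem K)) hlt hKw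
  have hσ : 0 ≤ α * M k := mul_nonneg (by linarith) (hH0.le.trans (hM_ge k))
  have hxk' := hxs k hk1 hks
  refine ⟨k, hkK, ?_, ?_⟩
  · obtain ⟨u, hu, hun⟩ := exists_subgradient_norm_le hp hf hLip hψconv hσ (hdne k hk1)
      (hdmem k hk1) (hdmin k hk1)
    rw [hxk']
    exact ⟨u, hu, hun.trans (mul_pow_le_of_root_mul_le_one (by omega) (by positivity) hεg hA
      (norm_nonneg _) (hcoef_le k)
      ((mul_le_mul_of_nonneg_right hw1 (norm_nonneg _)).trans hkw))⟩
  · intro hsec h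
    have hge := hw2 hsec
    obtain ⟨rfl, hψ0, hp2, -⟩ := hsec
    have h1 := hessian_ge hp2 hf hLip hσ (hdne k hk1)
      (fun z => by simpa [hψ0] using hdmin k hk1 z (Set.mem_univ _)) h
    have h2 := mul_pow_le_of_root_mul_le_one (q := p - 1) (by omega) (by positivity) hεH hA
      (norm_nonneg (d k)) (hcoef_le k)
      ((mul_le_mul_of_nonneg_right hge (norm_nonneg _)).trans hkw)
    rw [hxk']
    exact (neg_le_neg (mul_le_mul_of_nonneg_right h2 (sq_nonneg _))).trans h1
end
end

section
/- Consider the HAR-S method with budget B satisfying B ≥ Ū + 1, where Ū = ⌈log_{(α+1)/2}(H_max/H_0)⌉ and H_max = max{H_0, L_p}. Then for every k ≥ 1, the number of unsuccessful iterations among the first k satisfies |U ∩ {1, …, k}| ≤ ⌈k/B⌉ · Ū. -/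
open scoped BigOperators RealInnerProductSpace

noncomputable section

/-- One-dimensional Taylor upper bound for a tower of derivatives `G 0, …, G p` whose top member
grows at most linearly from its value at `0`. -/
lemma le_taylor_of_hasDerivAt_tower (p : ℕ) (C : ℝ) (G : ℕ → ℝ → ℝ)
    (hG : ∀ l < p, ∀ t, HasDerivAt (G l) (G (l + 1) t) t)
    (hp : ∀ t, 0 ≤ t → G p t ≤ G p 0 + C * t) {t : ℝ} (ht : 0 ≤ t) :
    G 0 t ≤ ∑ m ∈ Finset.range (p + 1), G m 0 * (t ^ m / (Nat.factorial m : ℝ))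
      + C * (t ^ (p + 1) / (Nat.factorial (p + 1) : ℝ)) := by
  have hpow (m : ℕ) (s : ℝ) :
      HasDerivAt (fun r : ℝ => r ^ (m + 1) / (Nat.factorial (m + 1) : ℝ))
        (s ^ m / (Nat.factorial m : ℝ)) s := by
    refine ((hasDerivAt_pow (m + 1) s).div_const _).congr_deriv ?_
    rw [Nat.factorial_succ]
    have := Nat.factorial_ne_zero m
    push_cast
    field_simp
  induction p generalizing G t with
  | zero => simpa using hp t ht
  | succ p ih =>
    have hderiv (s : ℝ) := by
      simpa using ih (fun l => G (l + 1)) (fun l hl => hG (l + 1) (by omega)) hp (t := s)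
    let P : ℝ → ℝ := fun s =>
      (∑ m ∈ Finset.range (p + 1), G (m + 1) 0 * (s ^ (m + 1) / (Nat.factorial (m + 1) : ℝ)) + G 0 0)
        + C * (s ^ (p + 2) / (Nat.factorial (p + 2) : ℝ))
    have hP (s : ℝ) : HasDerivAt P
        (∑ m ∈ Finset.range (p + 1), G (m + 1) 0 * (s ^ m / (Nat.factorial m : ℝ))
          + C * (s ^ (p + 1) / (Nat.factorial (p + 1) : ℝ))) s :=
      ((HasDerivAt.fun_sum fun m _ => (hpow m s).const_mul (G (m + 1) 0)).add_const _).add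
        ((hpow (p + 1) s).const_mul C)
    have hd (s : ℝ) := (hP s).sub (hG 0 (by omega) s)
    have hmono : MonotoneOn (P - G 0) (Set.Ici 0) := by
      refine monotoneOn_of_deriv_nonneg (convex_Ici 0)
        (fun s _ => (hd s).continuousAt.continuousWithinAt)
        (fun s _ => (hd s).differentiableAt.differentiableWithinAt) fun s hs => ?_
      rw [(hd s).deriv]
      rw [interior_Ici] at hs
      exact sub_nonneg.2 (hderiv s (le_of_lt hs))
    have h := hmono Set.self_mem_Ici ht ht
    have h0 : P 0 = G 0 0 := by simp [P]
    rw [Finset.sum_range_succ']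
    simp only [Pi.sub_apply, h0, sub_self, sub_nonneg] at h
    simpa [P] using h

/-- Taylor upper bound for a function whose `p`-th derivative is Lipschitz. -/
lemma sub_taylorPoly_le {n p : ℕ} {f : EuclideanSpace ℝ (Fin n) → ℝ} {L : ℝ}
    (hf : ContDiff ℝ p f)
    (hLip : ∀ x y : EuclideanSpace ℝ (Fin n),
      ‖iteratedFDeriv ℝ p f x - iteratedFDeriv ℝ p f y‖ ≤ L * ‖x - y‖)
    (x d : EuclideanSpace ℝ (Fin n)) :
    f (x + d) - taylorPoly p f x (x + d)
      ≤ L / (Nat.factorial (p + 1) : ℝ) * ‖d‖ ^ (p + 1) := by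
  have hline (t : ℝ) : HasDerivAt (fun s : ℝ => x + s • d) d t := by
    simpa using ((hasDerivAt_id t).smul_const d).const_add x
  have h := le_taylor_of_hasDerivAt_tower p (L * ‖d‖ ^ (p + 1))
    (fun l t => iteratedFDeriv ℝ l f (x + t • d) fun _ => d) ?_ ?_ zero_le_one
  · have hsum : taylorPoly p f x (x + d) = ∑ m ∈ Finset.range (p + 1),
        iteratedFDeriv ℝ m f x (fun _ => d) * (1 ^ m / (Nat.factorial m : ℝ)) := by
      rw [taylorPoly, Finset.range_eq_Ico, Finset.sum_eq_sum_Ico_succ_bot p.succ_pos, zero_add,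
        Nat.succ_eq_add_one, Finset.Ico_add_one_right_eq_Icc]
      simp [mul_comm]
    simp only [zero_smul, add_zero, one_smul, ← hsum] at h
    rw [iteratedFDeriv_zero_apply] at h
    calc _ ≤ L * ‖d‖ ^ (p + 1) * (1 ^ (p + 1) / (Nat.factorial (p + 1) : ℝ)) := by linarith
      _ = _ := by ring
  · intro l hl t
    have hd : HasFDerivAt (iteratedFDeriv ℝ l f) (fderiv ℝ (iteratedFDeriv ℝ l f) (x + t • d))
        (x + t • d) :=
      (hf.differentiable_iteratedFDeriv (by exact_mod_cast hl) _).hasFDerivAt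
    have h1 := hd.comp_hasDerivAt t (hline t)
    exact (ContinuousMultilinearMap.apply ℝ (fun _ : Fin l => EuclideanSpace ℝ (Fin n)) ℝ
      (fun _ => d)).hasFDerivAt.comp_hasDerivAt t h1
  · intro t ht
    have h1 := (iteratedFDeriv ℝ p f (x + t • d) - iteratedFDeriv ℝ p f x).le_opNorm fun _ => d
    have h2 := hLip (x + t • d) x
    rw [add_sub_cancel_left, norm_smul, Real.norm_of_nonneg ht] at h2
    rw [Finset.prod_const, Finset.card_univ, Fintype.card_fin] at h1
    have h3 := (le_abs_self _).trans (h1.trans (mul_le_mul_of_nonneg_right h2 (by positivity)))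
    rw [sub_apply] at h3
    simp only [zero_smul, add_zero]
    linear_combination h3

/-- If `H` jumps by a factor `β` above a running maximum at every index of `U`, then within a window
of at most `B` indices some value of `H` exceeds `β ^ c * h₀`, with `c` the number of jumps. -/
lemma exists_pow_mul_lt_of_jumps {H M : ℕ → ℝ} {h₀ β : ℝ} (hβ : 0 < β) {B : ℕ} (U : Finset ℕ)
    (hM₀ : ∀ j ∈ U, h₀ ≤ M j)
    (hM : ∀ j ∈ U, ∀ i, 1 ≤ i → j ≤ i + B → i < j → H i ≤ M j)
    (hU : ∀ j ∈ U, β * M j < H j) (s t : ℕ) (ht : t ≤ B) :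
    (U ∩ Finset.Ioc s (s + t)).card = 0 ∨
      ∃ j ∈ Finset.Ioc s (s + t), β ^ (U ∩ Finset.Ioc s (s + t)).card * h₀ < H j := by
  induction t with
  | zero => simp
  | succ t ih =>
    have hI : Finset.Ioc s (s + (t + 1)) = insert (s + t + 1) (Finset.Ioc s (s + t)) := by
      ext; simp; omega
    by_cases hmem : s + t + 1 ∈ U
    · right
      refine ⟨s + t + 1, by simp, ?_⟩
      rw [hI, Finset.inter_insert_of_mem hmem, Finset.card_insert_of_notMem (by simp)]
      have hle : β ^ (U ∩ Finset.Ioc s (s + t)).card * h₀ ≤ M (s + t + 1) := by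
        rcases ih (by omega) with h | ⟨j, hj, h⟩
        · simpa [h] using hM₀ _ hmem
        · rw [Finset.mem_Ioc] at hj
          exact h.le.trans (hM _ hmem j (by omega) (by omega) (by omega))
      calc _ = β * (β ^ (U ∩ Finset.Ioc s (s + t)).card * h₀) := by ring
        _ ≤ β * M (s + t + 1) := by gcongr
        _ < _ := hU _ hmem
    · rw [hI, Finset.inter_insert_of_notMem hmem]
      refine (ih (by omega)).imp_right fun ⟨j, hj, h⟩ =>
        ⟨j, Finset.mem_insert_of_mem hj, h⟩

lemma Ubar_nonneg {α H₀ L : ℝ} (hα : 1 < α) (hH₀ : 0 < H₀) : 0 ≤ Ubar α H₀ L :=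
  Int.ceil_nonneg <| Real.logb_nonneg (by linarith) <| (one_le_div hH₀).2 (le_max_left _ _)

/-- A set of indices meeting each window of length `B` in at most `u` points meets the first
`q * B` positive integers in at most `q * u` points. -/
lemma card_inter_Ioc_le (U : Finset ℕ) (B : ℕ) (u : ℤ)
    (h : ∀ s, ((U ∩ Finset.Ioc s (s + B)).card : ℤ) ≤ u) (q : ℕ) :
    ((U ∩ Finset.Ioc 0 (q * B)).card : ℤ) ≤ q * u := by
  induction q with
  | zero => simp
  | succ q ih =>
    have hsub : U ∩ Finset.Ioc 0 ((q + 1) * B)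
        ⊆ (U ∩ Finset.Ioc 0 (q * B)) ∪ (U ∩ Finset.Ioc (q * B) (q * B + B)) := by
      rw [← Finset.inter_union_distrib_left, Finset.Ioc_union_Ioc_eq_Ioc (by simp) (by simp),
        Nat.succ_mul]
    have hcard := (Finset.card_le_card hsub).trans (Finset.card_union_le _ _)
    have := h (q * B)
    push_cast
    zify at hcard
    linarith

theorem HARS_unsuccessful_count
    {n : ℕ} (p : ℕ) (hp : 1 ≤ p)
    (f : EuclideanSpace ℝ (Fin n) → ℝ) (Lp : ℝ)
    (hf : ContDiff ℝ p f)
    (hLip : ∀ x y : EuclideanSpace ℝ (Fin n),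
      ‖iteratedFDeriv ℝ p f x - iteratedFDeriv ℝ p f y‖ ≤ Lp * ‖x - y‖)
    (domψ : Set (EuclideanSpace ℝ (Fin n))) (ψ : EuclideanSpace ℝ (Fin n) → ℝ)
    (hdom_ne : domψ.Nonempty) (hdom_closed : IsClosed domψ) (hdom_conv : Convex ℝ domψ)
    (hψconv : ConvexOn ℝ domψ ψ) (hψlsc : LowerSemicontinuousOn ψ domψ)
    (xstar : EuclideanSpace ℝ (Fin n)) (hstar : xstar ∈ domψ)
    (hminF : ∀ z ∈ domψ, f xstar + ψ xstar ≤ f z + ψ z)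
    (α : ℝ) (hα : 1 < α)
    (x d : ℕ → EuclideanSpace ℝ (Fin n)) (H M : ℕ → ℝ)
    (hx0 : x 0 ∈ domψ) (hH0 : 0 < H 0) (hM0 : M 0 = H 0)
    (B : ℕ) (hB : Ubar α (H 0) Lp + 1 ≤ (B : ℤ))
    (hM : ∀ k, 1 ≤ k →
      M k = (insert (H 0) ((Finset.Icc (max 1 (k - B)) (k - 1)).image H)).max'
        (Finset.insert_nonempty _ _))
    (hdmem : ∀ k, 1 ≤ k → x (k - 1) + d k ∈ domψ)
    (hdmin : ∀ k, 1 ≤ k → ∀ z ∈ domψ,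
      omegaReg p (α * M k) f (x (k - 1)) (x (k - 1) + d k) + ψ (x (k - 1) + d k)
        ≤ omegaReg p (α * M k) f (x (k - 1)) z + ψ z)
    (hdne : ∀ k, 1 ≤ k → d k ≠ 0)
    (hxk : ∀ k, 1 ≤ k →
      x k = if f (x (k - 1) + d k) + ψ (x (k - 1) + d k) ≤ f (x (k - 1)) + ψ (x (k - 1))
            then x (k - 1) + d k else x (k - 1))
    (hHk : ∀ k, 1 ≤ k → H k / (Nat.factorial (p + 1) : ℝ)
      = (f (x (k - 1) + d k) - taylorPoly p f (x (k - 1)) (x (k - 1) + d k)) / ‖d k‖ ^ (p + 1)) :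
    ∀ k : ℕ, 1 ≤ k →
      (({j : ℕ | 1 ≤ j ∧ (α + 1) * M j < 2 * H j} ∩ Set.Icc 1 k).ncard : ℤ)
        ≤ ⌈(k : ℝ) / (B : ℝ)⌉ * Ubar α (H 0) Lp := by
  classical
  intro k _
  have hB1 : 1 ≤ B := by
    have := Ubar_nonneg (L := Lp) hα hH0
    omega
  have hHL (j : ℕ) (hj : 1 ≤ j) : H j ≤ Lp := by
    have h := sub_taylorPoly_le hf hLip (x (j - 1)) (d j)
    have hd : 0 < ‖d j‖ ^ (p + 1) := pow_pos (norm_pos_iff.2 (hdne j hj)) _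
    rw [← div_le_iff₀ hd, ← hHk j hj] at h
    exact (div_le_div_iff_of_pos_right (by positivity)).1 h
  have hMge (j : ℕ) (hj : 1 ≤ j) (i : ℕ) (hi : 1 ≤ i) (hij : j ≤ i + B) (hlt : i < j) :
      H i ≤ M j := by
    rw [hM j hj]
    exact Finset.le_max' _ _ (Finset.mem_insert_of_mem (Finset.mem_image_of_mem _
      (Finset.mem_Icc.2 (by omega))))
  have hM0ge (j : ℕ) (hj : 1 ≤ j) : H 0 ≤ M j := by
    rw [hM j hj]
    exact Finset.le_max' _ _ (Finset.mem_insert_self _ _)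
  let U : Finset ℕ := (Finset.Icc 1 k).filter fun j => (α + 1) * M j < 2 * H j
  have hU1 (j : ℕ) (hj : j ∈ U) : 1 ≤ j := (Finset.mem_Icc.1 (Finset.mem_filter.1 hj).1).1
  have hwindow (s : ℕ) : ((U ∩ Finset.Ioc s (s + B)).card : ℤ) ≤ Ubar α (H 0) Lp := by
    rcases exists_pow_mul_lt_of_jumps (β := (α + 1) / 2) (by linarith) U
      (fun j hj => hM0ge j (hU1 j hj)) (fun j hj => hMge j (hU1 j hj))
      (fun j hj => by linarith [(Finset.mem_filter.1 hj).2]) s B le_rfl with h | ⟨j, hj, h⟩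
    · rw [h]
      exact_mod_cast Ubar_nonneg hα hH0
    · have hlt := h.trans_le ((hHL j (by rw [Finset.mem_Ioc] at hj; omega)).trans
        (le_max_right (H 0) Lp))
      rw [← lt_div_iff₀ hH0, ← Real.rpow_natCast] at hlt
      have hpos : 0 < Hmax (H 0) Lp / H 0 := div_pos (lt_max_of_lt_left hH0) hH0
      have hlog := (Real.lt_logb_iff_rpow_lt (by linarith) hpos).2 hlt
      exact_mod_cast hlog.le.trans (Int.le_ceil _)
  have hset : {j : ℕ | 1 ≤ j ∧ (α + 1) * M j < 2 * H j} ∩ Set.Icc 1 k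
      = ↑(U ∩ Finset.Ioc 0 (⌈(k : ℝ) / (B : ℝ)⌉₊ * B)) := by
    have hk : k ≤ ⌈(k : ℝ) / (B : ℝ)⌉₊ * B := by
      have := Nat.le_ceil ((k : ℝ) / (B : ℝ))
      rw [div_le_iff₀ (by exact_mod_cast hB1)] at this
      exact_mod_cast this
    ext j
    simp only [U, Set.mem_inter_iff, Set.mem_ofPred_eq, Set.mem_Icc, Finset.coe_inter,
      Finset.mem_coe, Finset.mem_filter, Finset.mem_Icc, Finset.mem_Ioc]
    constructor
    · rintro ⟨⟨h1, h2⟩, h3⟩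
      exact ⟨⟨h3, h2⟩, by omega⟩
    · rintro ⟨⟨h1, h2⟩, h3⟩
      exact ⟨⟨h1.1, h2⟩, h1⟩
  rw [hset, Set.ncard_coe_finset, ← Int.natCast_ceil_eq_ceil (by positivity)]
  exact card_inter_Ioc_le U B _ hwindow _
end
end

section
/- Let p ≥ 1 be an integer, τ > 0, x^0, s ∈ ℝ^n, c ∈ ℝ, and define φ(x) = τ‖x − x^0‖^{p+1} + ⟨s, x⟩ + c. Set v = x^0 − ((p+1)τ)^{−1/p} ‖s‖^{−(p−1)/p} s if s ≠ 0, and v = x^0 if s = 0. Then v is the unique minimizer of φ over ℝ^n, and for every x ∈ ℝ^n, φ(x) ≥ φ(v) + (τ / 2^{p−1}) ‖x − v‖^{p+1}. (This is the content of the paper's Lemma on the estimating functions φ_k: each φ_k has exactly this form with τ = C_p(α,β)M_k and s = Σ_{i<k} a_i g^{i+1}, so v^k is the unique minimizer of φ_k and φ_k(x) ≥ φ_k^⋆ + (M_k C_p(α,β)/2^{p−1})‖x − v^k‖^{p+1}.) -/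
open scoped RealInnerProductSpace

section NormPow

variable {E : Type*} [NormedAddCommGroup E] [InnerProductSpace ℝ E]

/-- Strong monotonicity of the gradient of `‖·‖ ^ (m + 2) / (m + 2)`. -/
lemma norm_sub_pow_div_le_inner_norm_pow_smul_sub (m : ℕ) (a b : E) :
    ‖b - a‖ ^ (m + 2) / 2 ^ m ≤ ⟪‖b‖ ^ m • b - ‖a‖ ^ m • a, b - a⟫ := by
  have hexp : ⟪‖b‖ ^ m • b - ‖a‖ ^ m • a, b - a⟫
      = (‖b‖ ^ m + ‖a‖ ^ m) / 2 * ‖b - a‖ ^ 2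
        + (‖b‖ ^ m - ‖a‖ ^ m) * (‖b‖ ^ 2 - ‖a‖ ^ 2) / 2 := by
    rw [norm_sub_sq_real]
    simp only [inner_sub_left, inner_sub_right, real_inner_smul_left,
      real_inner_self_eq_norm_sq, real_inner_comm b a]
    ring
  have hcross : 0 ≤ (‖b‖ ^ m - ‖a‖ ^ m) * (‖b‖ ^ 2 - ‖a‖ ^ 2) := by
    rcases le_total ‖a‖ ‖b‖ with h | h
    · exact mul_nonneg (sub_nonneg.2 (by gcongr)) (sub_nonneg.2 (by gcongr))
    · exact mul_nonneg_of_nonpos_of_nonpos (sub_nonpos.2 (by gcongr)) (sub_nonpos.2 (by gcongr))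
  have hmean : ‖b - a‖ ^ m / 2 ^ m ≤ (‖b‖ ^ m + ‖a‖ ^ m) / 2 := by
    have hconv := (convexOn_pow m).2 (norm_nonneg b) (norm_nonneg a)
      (by norm_num : (0 : ℝ) ≤ 1 / 2) (by norm_num : (0 : ℝ) ≤ 1 / 2) (by norm_num)
    simp only [smul_eq_mul] at hconv
    calc ‖b - a‖ ^ m / 2 ^ m ≤ (‖b‖ + ‖a‖) ^ m / 2 ^ m := by gcongr; exact norm_sub_le b a
      _ = (1 / 2 * ‖b‖ + 1 / 2 * ‖a‖) ^ m := by rw [← div_pow]; congr 1; ring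
      _ ≤ _ := by linarith
  rw [hexp]
  calc ‖b - a‖ ^ (m + 2) / 2 ^ m = ‖b - a‖ ^ m / 2 ^ m * ‖b - a‖ ^ 2 := by ring
    _ ≤ (‖b‖ ^ m + ‖a‖ ^ m) / 2 * ‖b - a‖ ^ 2 := by gcongr
    _ ≤ _ := by linarith

lemma hasDerivAt_norm_add_smul_pow (m : ℕ) (a h : E) (t : ℝ) :
    HasDerivAt (fun t : ℝ => ‖a + t • h‖ ^ (m + 2))
      ((m + 2) * (‖a + t • h‖ ^ m * ⟪a + t • h, h⟫)) t := by
  have hline : HasDerivAt (fun t : ℝ => a + t • h) h t := by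
    simpa using ((hasDerivAt_id t).smul_const h).const_add a
  have hnorm := hasFDerivAt_norm_rpow (a + t • h) (p := ((m + 2 : ℕ) : ℝ))
    (by push_cast; linarith [(m.cast_nonneg : (0 : ℝ) ≤ m)])
  have hcomp := hnorm.comp_hasDerivAt t hline
  have hsub : ((m + 2 : ℕ) : ℝ) - 2 = (m : ℕ) := by push_cast; ring
  simp only [hsub, Real.rpow_natCast] at hcomp
  refine HasDerivAt.congr_deriv (f := fun t : ℝ => ‖a + t • h‖ ^ (m + 2)) hcomp ?_
  rw [smul_apply, innerSL_apply_apply, smul_eq_mul]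
  push_cast
  ring

/-- Uniform convexity of `‖·‖ ^ (m + 2)`. -/
lemma norm_pow_add_le_norm_add_pow (m : ℕ) (a h : E) :
    ‖a‖ ^ (m + 2) + (m + 2) * (‖a‖ ^ m * ⟪a, h⟫) + ‖h‖ ^ (m + 2) / 2 ^ m
      ≤ ‖a + h‖ ^ (m + 2) := by
  let g : ℝ → ℝ := fun t => ‖a + t • h‖ ^ (m + 2) - t * ((m + 2) * (‖a‖ ^ m * ⟪a, h⟫))
    - t ^ (m + 2) * (‖h‖ ^ (m + 2) / 2 ^ m)
  have hg (t : ℝ) : HasDerivAt g ((m + 2) * (‖a + t • h‖ ^ m * ⟪a + t • h, h⟫)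
      - (m + 2) * (‖a‖ ^ m * ⟪a, h⟫)
      - (m + 2) * t ^ (m + 1) * (‖h‖ ^ (m + 2) / 2 ^ m)) t := by
    have hlin := (hasDerivAt_id t).mul_const (((m : ℝ) + 2) * (‖a‖ ^ m * ⟪a, h⟫))
    have hpow := (hasDerivAt_pow (m + 2) t).mul_const (‖h‖ ^ (m + 2) / 2 ^ m)
    refine HasDerivAt.congr_deriv (f := g)
      (((hasDerivAt_norm_add_smul_pow m a h t).sub hlin).sub hpow) ?_
    simp
  have hmono : MonotoneOn g (Set.Icc 0 1) := by
    refine monotoneOn_of_deriv_nonneg (convex_Icc 0 1)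
      (fun t _ => (hg t).continuousAt.continuousWithinAt)
      (fun t _ => (hg t).differentiableAt.differentiableWithinAt) fun t ht => ?_
    rw [interior_Icc] at ht
    have ht0 : 0 < t := ht.1
    have key := norm_sub_pow_div_le_inner_norm_pow_smul_sub m a (a + t • h)
    rw [add_sub_cancel_left, norm_smul, Real.norm_of_nonneg ht0.le, real_inner_smul_right,
      inner_sub_left, real_inner_smul_left, real_inner_smul_left] at key
    have key' : t ^ (m + 1) * (‖h‖ ^ (m + 2) / 2 ^ m)
        ≤ ‖a + t • h‖ ^ m * ⟪a + t • h, h⟫ - ‖a‖ ^ m * ⟪a, h⟫ := by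
      refine le_of_mul_le_mul_left (le_trans (le_of_eq ?_) key) ht0
      ring
    rw [(hg t).deriv]
    have hm : (0 : ℝ) ≤ m + 2 := by positivity
    nlinarith [mul_le_mul_of_nonneg_left key' hm]
  have h01 := hmono (Set.left_mem_Icc.2 zero_le_one) (Set.right_mem_Icc.2 zero_le_one) zero_le_one
  simp only [g, zero_smul, add_zero, one_smul, one_mul, zero_mul, one_pow, sub_zero,
    zero_pow (Nat.succ_ne_zero (m + 1))] at h01
  linarith

end NormPow



theorem uniformly_convex_estimating_function {n : ℕ} (p : ℕ) (hp : 1 ≤ p)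
    (τ : ℝ) (hτ : 0 < τ) (x0 s : EuclideanSpace ℝ (Fin n)) (c : ℝ)
    (v : EuclideanSpace ℝ (Fin n))
    (hv0 : s = 0 → v = x0)
    (hv : s ≠ 0 → v = x0
      - (((((p : ℝ) + 1) * τ) ^ (-((1 : ℝ) / (p : ℝ)))
          * ‖s‖ ^ (-(((p : ℝ) - 1) / (p : ℝ)))) • s)) :
    (∀ x : EuclideanSpace ℝ (Fin n), x ≠ v →
      τ * ‖v - x0‖ ^ (p + 1) + ⟪s, v⟫ + c < τ * ‖x - x0‖ ^ (p + 1) + ⟪s, x⟫ + c) ∧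
    (∀ x : EuclideanSpace ℝ (Fin n),
      (τ * ‖v - x0‖ ^ (p + 1) + ⟪s, v⟫ + c) + (τ / 2 ^ (p - 1)) * ‖x - v‖ ^ (p + 1)
        ≤ τ * ‖x - x0‖ ^ (p + 1) + ⟪s, x⟫ + c) := by
  obtain ⟨m, rfl⟩ : ∃ m, p = m + 1 := ⟨p - 1, by omega⟩
  have hgrad : s = -((τ * (m + 2) * ‖v - x0‖ ^ m) • (v - x0)) := by
    by_cases hs : s = 0
    · simp [hv0 hs, hs]
    · have hs' : 0 < ‖s‖ := norm_pos_iff.2 hs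
      have hm : (0 : ℝ) < (m : ℝ) + 1 := by positivity
      have hq : (0 : ℝ) < (((m + 1 : ℕ) : ℝ) + 1) * τ := by positivity
      have hv := hv hs
      set k : ℝ := ((((m + 1 : ℕ) : ℝ) + 1) * τ) ^ (-((1 : ℝ) / ((m + 1 : ℕ) : ℝ)))
          * ‖s‖ ^ (-((((m + 1 : ℕ) : ℝ) - 1) / ((m + 1 : ℕ) : ℝ))) with hk
      have hk0 : 0 ≤ k := by positivity
      have hkp : k ^ (m + 1) = ((((m + 1 : ℕ) : ℝ) + 1) * τ)⁻¹ * (‖s‖ ^ m)⁻¹ := by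
        rw [hk, mul_pow, ← Real.rpow_mul_natCast hq.le, ← Real.rpow_mul_natCast hs'.le]
        congr 1
        · rw [← Real.rpow_neg_one]
          congr 1
          push_cast
          field_simp
        · rw [← Real.rpow_natCast ‖s‖ m, ← Real.rpow_neg hs'.le]
          congr 1
          push_cast
          field_simp
          ring
      have hva : v - x0 = -(k • s) := by rw [hv]; abel
      have hone : τ * (m + 2) * (k * ‖s‖) ^ m * k = 1 := by
        calc τ * (m + 2) * (k * ‖s‖) ^ m * k = τ * (m + 2) * ‖s‖ ^ m * k ^ (m + 1) := by ring
          _ = 1 := by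
            rw [hkp]
            push_cast
            field_simp
            ring
      rw [hva, norm_neg, norm_smul, Real.norm_of_nonneg hk0, smul_neg, neg_neg, smul_smul, hone,
        one_smul]
  have hbound (x : EuclideanSpace ℝ (Fin n)) :
      (τ * ‖v - x0‖ ^ (m + 1 + 1) + ⟪s, v⟫ + c) + (τ / 2 ^ (m + 1 - 1)) * ‖x - v‖ ^ (m + 1 + 1)
        ≤ τ * ‖x - x0‖ ^ (m + 1 + 1) + ⟪s, x⟫ + c := by
    have key := norm_pow_add_le_norm_add_pow m (v - x0) (x - v)
    rw [show v - x0 + (x - v) = x - x0 by abel] at key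
    have hinner : ⟪s, x⟫ - ⟪s, v⟫ = -(τ * (m + 2) * ‖v - x0‖ ^ m * ⟪v - x0, x - v⟫) := by
      rw [← inner_sub_right]
      conv_lhs => rw [hgrad]
      rw [inner_neg_left, real_inner_smul_left]
    have hτkey := mul_le_mul_of_nonneg_left key hτ.le
    have hdiv : τ / 2 ^ m * ‖x - v‖ ^ (m + 2) = τ * (‖x - v‖ ^ (m + 2) / 2 ^ m) := by ring
    rw [Nat.add_sub_cancel, show m + 1 + 1 = m + 2 from rfl, hdiv]
    linarith
  refine ⟨fun x hx => ?_, hbound⟩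
  have hpos : 0 < ‖x - v‖ := norm_pos_iff.2 (sub_ne_zero.2 hx)
  have hgap : 0 < (τ / 2 ^ (m + 1 - 1)) * ‖x - v‖ ^ (m + 1 + 1) := by positivity
  linarith [hbound x]
end
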